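/- Let I = (0,a), 0 < a ≤ ∞, let φ be an N-function with complementary function φ*, and let w be a positive decreasing weight function on I with W(t) = ∫₀ᵗ w < ∞ for all t ∈ I. Then the Köthe dual of the space 𝓜_{φ,w} (with norm ‖f‖_𝓜 = inf{ε>0 : P(f/ε) ≤ 1}, P(f) = inf{∫_I φ(|f|/v) v : v ≥ 0, v ≺ w}) is the Orlicz–Lorentz space Λ_{φ*,w} equipped with its Orlicz norm: (𝓜_{φ,w})' = Λ⁰_{φ*,w} as sets, with equality of norms, i.e. for every g ∈ Λ_{φ*,w}, sup{ ∫_I |gh| : h ∈ 𝓜_{φ,w}, ‖h‖_𝓜 ≤ 1 } = ‖g‖⁰_{Λ_{φ*,w}}. -/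

import Mathlib

open MeasureTheory Set Filter Topology ENNReal

noncomputable section

namespace OrliczRearrangement

/-- An Orlicz function: convex on `[0,∞)`, strictly increasing on `[0,∞)` and vanishing at `0`. -/
def IsOrliczFn (φ : ℝ → ℝ) : Prop :=
  ConvexOn ℝ (Set.Ici 0) φ ∧ StrictMonoOn φ (Set.Ici 0) ∧ φ 0 = 0

/-- An `N`-function: an Orlicz function with `φ(t)/t → 0` as `t → 0⁺` and `φ(t)/t → ∞`
as `t → ∞`. -/
def IsNFn (φ : ℝ → ℝ) : Prop :=
  IsOrliczFn φ ∧ Filter.Tendsto (fun t => φ t / t) (nhdsWithin 0 (Set.Ioi 0)) (nhds 0) ∧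
    Filter.Tendsto (fun t => φ t / t) Filter.atTop Filter.atTop

/-- The complementary (conjugate) function `φ*(t) = sup_{s>0} (st - φ(s))`. -/
def conjFn (φ : ℝ → ℝ) (t : ℝ) : ℝ := sSup ((fun s => s * t - φ s) '' Set.Ioi 0)

/-- The interval `I = (0,a)`, `0 < a ≤ ∞`, as a subset of `ℝ`. -/
def Ioa' (a : ℝ≥0∞) : Set ℝ := {t : ℝ | 0 < t ∧ ENNReal.ofReal t < a}

/-- Distribution function `d_f(s) = |{t ∈ (0,a) : |f(t)| > s}|`. -/
def distr (a : ℝ≥0∞) (f : ℝ → ℝ) (s : ℝ) : ℝ≥0∞ := volume {t ∈ Ioa' a | s < |f t|}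

/-- Decreasing rearrangement `f*(t) = inf{s ≥ 0 : d_f(s) ≤ t}` of `f` on `(0,a)`,
with value `∞` when no such `s` exists. -/
def decRe (a : ℝ≥0∞) (f : ℝ → ℝ) (t : ℝ) : ℝ≥0∞ :=
  sInf (ENNReal.ofReal '' {s : ℝ | 0 ≤ s ∧ distr a f s ≤ ENNReal.ofReal t})

/-- Distribution of a sequence: `d_x(s) = |{k : |x(k)| > s}|`. -/
def sdistr (x : ℕ → ℝ) (s : ℝ) : ℕ∞ := {k : ℕ | s < |x k|}.encard

/-- Decreasing rearrangement of a sequence (`0`-indexed):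
`x*(n) = inf{s > 0 : d_x(s) ≤ n}`, with value `∞` when no such `s` exists. -/
def sdecRe (x : ℕ → ℝ) (n : ℕ) : ℝ≥0∞ :=
  sInf (ENNReal.ofReal '' {s : ℝ | 0 < s ∧ sdistr x s ≤ (n : ℕ∞)})

/-- The extended-real quantity `φ(c/v)·v`, with the convention that for `v = 0` it equals
`0` if `c = 0` and `∞` if `c ≠ 0`. -/
def oterm (φ : ℝ → ℝ) (c v : ℝ) : ℝ≥0∞ :=
  if v = 0 then (if c = 0 then 0 else ∞) else ENNReal.ofReal (φ (c / v) * v)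

/-- The quantity `φ(c/v)·v` for an extended-real numerator `c`; it equals `∞` when
`c = ∞`. -/
def otermE (φ : ℝ → ℝ) (c : ℝ≥0∞) (v : ℝ) : ℝ≥0∞ :=
  if c = ∞ then ∞ else oterm φ c.toReal v

/-- The modular `M(f) = ∫_I φ(f*/w)·w`. -/
def Mmod (a : ℝ≥0∞) (φ w f : ℝ → ℝ) : ℝ≥0∞ :=
  ∫⁻ t in Ioa' a, otermE φ (decRe a f t) (w t)

/-- The functional `‖f‖_M = inf{ε > 0 : M(f/ε) ≤ 1}` (equal to `∞` if no such `ε`). -/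
def Mnorm (a : ℝ≥0∞) (φ w f : ℝ → ℝ) : ℝ≥0∞ :=
  ⨅ ε ∈ {ε : ℝ | 0 < ε ∧ Mmod a φ w (fun t => f t / ε) ≤ 1}, ENNReal.ofReal ε

/-- The class `M_{φ,w}` of measurable `f` with `M(λf) < ∞` for some `λ > 0`. -/
def Mclass (a : ℝ≥0∞) (φ w : ℝ → ℝ) : Set (ℝ → ℝ) :=
  {f | Measurable f ∧ ∃ c > 0, Mmod a φ w (fun t => c * f t) < ∞}

/-- Submajorization `v ≺ w` on `(0,a)`: `∫₀ᵗ v* ≤ ∫₀ᵗ w*` for all `t ∈ (0,a)`. -/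
def Submaj (a : ℝ≥0∞) (v w : ℝ → ℝ) : Prop :=
  ∀ t ∈ Ioa' a, ∫⁻ s in Set.Ioo 0 t, decRe a v s ≤ ∫⁻ s in Set.Ioo 0 t, decRe a w s

/-- The modular `P`, for (decreasing-rearrangement-like) `[0,∞]`-valued data `F`:
`P(F) = inf{∫_I φ(F/v)·v : v ≥ 0, v ≺ w}`. -/
def PmodE (a : ℝ≥0∞) (φ w : ℝ → ℝ) (F : ℝ → ℝ≥0∞) : ℝ≥0∞ :=
  ⨅ v ∈ {v : ℝ → ℝ | Measurable v ∧ (∀ t, 0 ≤ v t) ∧ Submaj a v w},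
    ∫⁻ t in Ioa' a, otermE φ (F t) (v t)

/-- The modular `P(f) = inf{∫_I φ(|f|/v)·v : v ≥ 0, v ≺ w}`. -/
def Pmod (a : ℝ≥0∞) (φ w f : ℝ → ℝ) : ℝ≥0∞ :=
  PmodE a φ w fun t => ENNReal.ofReal |f t|

/-- The norm of `𝓜_{φ,w}` for `[0,∞]`-valued data. -/
def PnormE (a : ℝ≥0∞) (φ w : ℝ → ℝ) (F : ℝ → ℝ≥0∞) : ℝ≥0∞ :=
  ⨅ ε ∈ {ε : ℝ | 0 < ε ∧ PmodE a φ w (fun t => F t / ENNReal.ofReal ε) ≤ 1},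
    ENNReal.ofReal ε

/-- The norm `‖f‖_𝓜 = inf{ε > 0 : P(f/ε) ≤ 1}`. -/
def Pnorm (a : ℝ≥0∞) (φ w f : ℝ → ℝ) : ℝ≥0∞ :=
  PnormE a φ w fun t => ENNReal.ofReal |f t|

/-- The space `𝓜_{φ,w}` of measurable `f` with `P(λf) < ∞` for some `λ > 0`. -/
def Pclass (a : ℝ≥0∞) (φ w : ℝ → ℝ) : Set (ℝ → ℝ) :=
  {f | Measurable f ∧ ∃ c > 0, Pmod a φ w (fun t => c * f t) < ∞}

/-- Sequence submajorization `v ≺ w`. -/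
def sSubmaj (v w : ℕ → ℝ) : Prop :=
  ∀ m : ℕ, ∑ n ∈ Finset.range m, sdecRe v n ≤ ∑ n ∈ Finset.range m, sdecRe w n

/-- Sequence modular `p` for `[0,∞]`-valued data. -/
def spmodE (φ : ℝ → ℝ) (w : ℕ → ℝ) (X : ℕ → ℝ≥0∞) : ℝ≥0∞ :=
  ⨅ v ∈ {v : ℕ → ℝ | (∀ n, 0 ≤ v n) ∧ sSubmaj v w}, ∑' n, otermE φ (X n) (v n)

/-- Sequence modular `p(x) = inf{∑ φ(|x(n)|/v(n))·v(n) : v ≥ 0, v ≺ w}`. -/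
def spmod (φ : ℝ → ℝ) (w x : ℕ → ℝ) : ℝ≥0∞ :=
  spmodE φ w fun n => ENNReal.ofReal |x n|

/-- Sequence norm for `[0,∞]`-valued data. -/
def spnormE (φ : ℝ → ℝ) (w : ℕ → ℝ) (X : ℕ → ℝ≥0∞) : ℝ≥0∞ :=
  ⨅ ε ∈ {ε : ℝ | 0 < ε ∧ spmodE φ w (fun n => X n / ENNReal.ofReal ε) ≤ 1},
    ENNReal.ofReal ε

/-- Sequence norm `‖x‖_𝔪 = inf{ε > 0 : p(x/ε) ≤ 1}`. -/
def spnorm (φ : ℝ → ℝ) (w x : ℕ → ℝ) : ℝ≥0∞ :=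
  spnormE φ w fun n => ENNReal.ofReal |x n|

/-- Dilation operator `D₂f(t) = f(t/2)`, where `f` is extended by `0` outside `(0,a)`. -/
def D2 (a : ℝ≥0∞) (f : ℝ → ℝ) : ℝ → ℝ := fun t => (Ioa' a).indicator f (t / 2)

/-- A measure preserving transformation from `S` onto `S`. -/
def MeasPresOn (σ : ℝ → ℝ) (S : Set ℝ) : Prop :=
  Set.MapsTo σ S S ∧ Set.SurjOn σ S S ∧ Measurable σ ∧
    ∀ A : Set ℝ, A ⊆ S → MeasurableSet A → volume (S ∩ σ ⁻¹' A) = volume A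

/-- Luxemburg norm of the weighted Orlicz space `L_φ(w)` on `(0,a)`. -/
def luxNorm (a : ℝ≥0∞) (φ w g : ℝ → ℝ) : ℝ≥0∞ :=
  ⨅ ε ∈ {ε : ℝ | 0 < ε ∧
      ∫⁻ t in Ioa' a, ENNReal.ofReal (φ (|g t| / ε) * w t) ≤ 1}, ENNReal.ofReal ε

/-- The Orlicz norm of `f` in `Λ_{φ*,w}`, defined by duality with the unit ball of
`L_φ(w)`: `‖f‖⁰ = sup{∫_I f° g w : g ≥ 0, ‖g‖_{L_φ(w)} ≤ 1}`. -/
def lamOnorm (a : ℝ≥0∞) (φ w f : ℝ → ℝ) : ℝ≥0∞ :=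
  ⨆ g ∈ {g : ℝ → ℝ | Measurable g ∧ (∀ t, 0 ≤ g t) ∧ luxNorm a φ w g ≤ 1},
    ∫⁻ t in Ioa' a, decRe a f t * ENNReal.ofReal (g t * w t)

/-- The Orlicz–Lorentz class `Λ_{φs,w}`: measurable `g` whose (finite) decreasing
rearrangement satisfies `∫_I φs(c·g°)·w < ∞` for some `c > 0`. -/
def LamClass (a : ℝ≥0∞) (φs w : ℝ → ℝ) : Set (ℝ → ℝ) :=
  {g | Measurable g ∧ (∀ t ∈ Ioa' a, decRe a g t < ∞) ∧
    ∃ c > 0, ∫⁻ t in Ioa' a, ENNReal.ofReal (φs (c * (decRe a g t).toReal) * w t) < ∞}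

/-- The (generalized right-continuous) inverse `φ⁻¹(y) = inf{s ≥ 0 : φ(s) ≥ y}`. -/
def phiInv (φ : ℝ → ℝ) (y : ℝ) : ℝ := sInf {s : ℝ | 0 ≤ s ∧ y ≤ φ s}

lemma measurableSet_Ioa' (T : ℝ≥0∞) : MeasurableSet (Ioa' T) :=
  (measurableSet_lt measurable_const measurable_id).inter
    (measurableSet_lt ENNReal.measurable_ofReal measurable_const)

lemma volume_Ioa' (T : ℝ≥0∞) : volume (Ioa' T) = T := by
  rcases eq_or_ne T ∞ with rfl | hT
  · have : Ioa' ∞ = Ioi 0 := by ext; simp [Ioa']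
    rw [this, Real.volume_Ioi]
  · have : Ioa' T = Ioo 0 T.toReal := by
      ext t
      simp only [Ioa', mem_ofPred_eq, mem_Ioo]
      refine and_congr_right fun ht => ?_
      rw [ENNReal.ofReal_lt_iff_lt_toReal ht.le hT]
    rw [this, Real.volume_Ioo, sub_zero, ENNReal.ofReal_toReal hT]

lemma Ioa'_mono {S T : ℝ≥0∞} (h : S ≤ T) : Ioa' S ⊆ Ioa' T := fun _ ht => ⟨ht.1, ht.2.trans_le h⟩

lemma Ioa'_inter (S T : ℝ≥0∞) : Ioa' S ∩ Ioa' T = Ioa' (min S T) := by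
  ext t
  simp only [Ioa', mem_inter_iff, mem_ofPred_eq, lt_min_iff]
  tauto

lemma Ioa'_ofReal (t : ℝ) : Ioa' (ENNReal.ofReal t) = Ioo 0 t := by
  ext s
  simp only [Ioa', mem_ofPred_eq, mem_Ioo]
  refine and_congr_right fun hs => ?_
  rw [ENNReal.ofReal_lt_ofReal_iff_of_nonneg hs.le]

/-- Layer-cake formula for `[0,∞]`-valued functions. -/
lemma lintegral_eq_lintegral_measure_Ioa' {ν : Measure ℝ} [SFinite ν] {F : ℝ → ℝ≥0∞}
    (hF : Measurable F) : ∫⁻ x, F x ∂ν = ∫⁻ s, ν {x | s ∈ Ioa' (F x)} := by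
  have hR : MeasurableSet {p : ℝ × ℝ | p.2 ∈ Ioa' (F p.1)} :=
    (measurableSet_lt measurable_const measurable_snd).inter
      (measurableSet_lt (ENNReal.measurable_ofReal.comp measurable_snd) (hF.comp measurable_fst))
  have h1 := Measure.prod_apply (μ := ν) (ν := volume) hR
  have h2 := Measure.prod_apply_symm (μ := ν) (ν := volume) hR
  rw [h1] at h2
  calc ∫⁻ x, F x ∂ν = ∫⁻ x, volume (Ioa' (F x)) ∂ν := by simp only [volume_Ioa']
    _ = _ := h2

lemma setLIntegral_eq_of_eq_zero {S T : Set ℝ} {f : ℝ → ℝ≥0∞} (hS : MeasurableSet S)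
    (hT : MeasurableSet T) (hTS : T ⊆ S) (h : ∀ x ∈ S, x ∉ T → f x = 0) :
    ∫⁻ x in S, f x = ∫⁻ x in T, f x := by
  have : ∫⁻ x in S, f x = ∫⁻ x in S, T.indicator f x :=
    setLIntegral_congr_fun hS fun x hx => by
      by_cases hxT : x ∈ T
      · simp [hxT]
      · simp [hxT, h x hx hxT]
  rw [this, setLIntegral_indicator hT, inter_eq_left.2 hTS]

lemma distr_anti (a : ℝ≥0∞) (f : ℝ → ℝ) : Antitone (distr a f) := fun _ _ hst =>
  measure_mono (show {t ∈ Ioa' a | _ < |f t|} ⊆ {t ∈ Ioa' a | _ < |f t|} from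
    fun _ hx => ⟨hx.1, hst.trans_lt hx.2⟩)

lemma ofReal_lt_decRe_iff {a : ℝ≥0∞} {f : ℝ → ℝ} {s t : ℝ} (hs : 0 ≤ s) :
    ENNReal.ofReal s < decRe a f t ↔ ENNReal.ofReal t < distr a f s := by
  constructor
  · intro h
    by_contra! hc
    exact absurd (show decRe a f t ≤ ENNReal.ofReal s from sInf_le ⟨s, ⟨hs, hc⟩, rfl⟩) (not_le.2 h)
  · intro h
    by_contra! hc
    refine absurd h (not_lt.2 ?_)
    have hU : {x ∈ Ioa' a | s < |f x|} = ⋃ n : ℕ, {x ∈ Ioa' a | s + 1 / (n + 1 : ℝ) < |f x|} := by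
      ext x
      simp only [mem_ofPred_eq, mem_iUnion]
      constructor
      · rintro ⟨hx, hx'⟩
        obtain ⟨n, hn⟩ := exists_nat_one_div_lt (sub_pos.2 hx')
        exact ⟨n, hx, by linarith⟩
      · rintro ⟨n, hx, hx'⟩
        have : (0 : ℝ) < 1 / (n + 1 : ℝ) := by positivity
        exact ⟨hx, by linarith⟩
    have hm : Monotone fun n : ℕ => {x ∈ Ioa' a | s + 1 / (n + 1 : ℝ) < |f x|} := by
      intro m n hmn x hx
      refine ⟨hx.1, lt_of_le_of_lt ?_ hx.2⟩
      have : 1 / ((n : ℝ) + 1) ≤ 1 / ((m : ℝ) + 1) := Nat.one_div_le_one_div hmn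
      linarith
    rw [distr, hU, hm.measure_iUnion]
    refine iSup_le fun n => ?_
    have hlt : decRe a f t < ENNReal.ofReal (s + 1 / (n + 1 : ℝ)) :=
      hc.trans_lt ((ENNReal.ofReal_lt_ofReal_iff (by positivity)).2 (by
        have : (0 : ℝ) < 1 / (n + 1 : ℝ) := by positivity
        linarith))
    obtain ⟨_, ⟨r, ⟨hr0, hr⟩, rfl⟩, hr'⟩ := sInf_lt_iff.1 hlt
    exact (distr_anti a f ((ENNReal.ofReal_lt_ofReal_iff (by positivity)).1 hr').le).trans hr

lemma distr_decRe_le {a : ℝ≥0∞} {f : ℝ → ℝ} {t : ℝ} (h : decRe a f t < ∞) :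
    distr a f (decRe a f t).toReal ≤ ENNReal.ofReal t := by
  by_contra! hc
  have := (ofReal_lt_decRe_iff ENNReal.toReal_nonneg).2 hc
  rw [ENNReal.ofReal_toReal h.ne] at this
  exact lt_irrefl _ this

lemma decRe_anti (a : ℝ≥0∞) (f : ℝ → ℝ) : Antitone (decRe a f) := fun _ _ hst =>
  sInf_le_sInf (Set.image_mono fun _ hr => ⟨hr.1, hr.2.trans (ENNReal.ofReal_le_ofReal hst)⟩)

lemma measurable_decRe (a : ℝ≥0∞) (f : ℝ → ℝ) : Measurable (decRe a f) :=
  (decRe_anti a f).measurable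

lemma le_of_forall_ofReal_lt {x y : ℝ≥0∞}
    (h : ∀ s : ℝ, 0 ≤ s → ENNReal.ofReal s < x → ENNReal.ofReal s < y) : x ≤ y := by
  by_contra! hc
  have hy : y ≠ ∞ := hc.ne_top
  have := h y.toReal ENNReal.toReal_nonneg (by rwa [ENNReal.ofReal_toReal hy])
  rw [ENNReal.ofReal_toReal hy] at this
  exact lt_irrefl _ this

/-- `∫_E |v| ≤ ∫_0^{|E|} v°`. -/
lemma setLIntegral_le_lintegral_decRe {a : ℝ≥0∞} {v : ℝ → ℝ} (hv : Measurable v)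
    {E : Set ℝ} (hEI : E ⊆ Ioa' a) :
    ∫⁻ x in E, ENNReal.ofReal |v x| ≤ ∫⁻ x in Ioa' (volume E), decRe a v x := by
  rw [lintegral_eq_lintegral_measure_Ioa' (hv.abs.ennreal_ofReal),
    lintegral_eq_lintegral_measure_Ioa' (measurable_decRe a v)]
  refine lintegral_mono fun s => ?_
  rcases le_or_gt s 0 with hs | hs
  · have : {x | s ∈ Ioa' (ENNReal.ofReal |v x|)} = ∅ := by
      ext x; simp [Ioa', hs]
    simp [this]
  have e1 : {x | s ∈ Ioa' (ENNReal.ofReal |v x|)} = {x | s < |v x|} := by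
    ext x; simp [Ioa', hs, ENNReal.ofReal_lt_ofReal_iff_of_nonneg hs.le]
  have e2 : {x | s ∈ Ioa' (decRe a v x)} ∩ Ioa' (volume E) =
      Ioa' (min (distr a v s) (volume E)) := by
    rw [← Ioa'_inter]
    ext x
    simp only [Ioa', mem_inter_iff, mem_ofPred_eq, hs, true_and, ofReal_lt_decRe_iff hs.le]
    tauto
  rw [Measure.restrict_apply' (measurableSet_Ioa' _), e2, volume_Ioa', e1,
    Measure.restrict_apply (measurableSet_lt measurable_const hv.abs)]
  exact le_min (measure_mono fun x hx => ⟨hEI hx.2, hx.1⟩) (measure_mono inter_subset_right)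

/-- Every interval `(0,T)` is exhausted by intervals `(0,t n)` with `t n < T`. -/
lemma exists_exhaustion {T : ℝ≥0∞} (hT : 0 < T) : ∃ t : ℕ → ℝ, Monotone t ∧
    (∀ n, t n ∈ Ioa' T) ∧ Ioa' T = ⋃ n, Ioo 0 (t n) := by
  obtain ⟨u, hu, hu', hlim⟩ := exists_seq_strictMono_tendsto' hT
  have hfin : ∀ n, u n ≠ ∞ := fun n => (hu' n).2.ne_top
  refine ⟨fun n => (u n).toReal, fun m n h => ENNReal.toReal_mono (hfin n) (hu.monotone h),
    fun n => ⟨ENNReal.toReal_pos (hu' n).1.ne' (hfin n), ?_⟩, ?_⟩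
  · rw [ENNReal.ofReal_toReal (hfin n)]
    exact (hu' n).2
  · ext x
    simp only [Ioa', mem_ofPred_eq, mem_iUnion, mem_Ioo]
    constructor
    · rintro ⟨hx, hxT⟩
      obtain ⟨n, hn⟩ := (hlim.eventually (lt_mem_nhds hxT)).exists
      exact ⟨n, hx, (ENNReal.ofReal_lt_iff_lt_toReal hx.le (hfin n)).1 hn⟩
    · rintro ⟨n, hx, hn⟩
      exact ⟨hx, ((ENNReal.ofReal_lt_iff_lt_toReal hx.le (hfin n)).2 hn).trans (hu' n).2⟩

section Weight

variable {a : ℝ≥0∞} {w : ℝ → ℝ}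

lemma decRe_le_of_antitoneOn (hw_pos : ∀ t ∈ Ioa' a, 0 < w t)
    (hw_dec : ∀ s ∈ Ioa' a, ∀ t ∈ Ioa' a, s ≤ t → w t ≤ w s) {t : ℝ} (ht : t ∈ Ioa' a) :
    decRe a w t ≤ ENNReal.ofReal (w t) := by
  refine sInf_le ⟨w t, ⟨(hw_pos t ht).le, ?_⟩, rfl⟩
  calc distr a w (w t) ≤ volume (Ioo 0 t) := measure_mono fun x hx => by
        refine ⟨hx.1.1, ?_⟩
        by_contra! hc
        have h1 := hx.2
        rw [abs_of_pos (hw_pos x hx.1)] at h1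
        exact absurd (hw_dec t ht x hx.1 hc) (not_le.2 h1)
    _ = ENNReal.ofReal t := by rw [Real.volume_Ioo, sub_zero]

lemma Submaj.lintegral_le {v : ℝ → ℝ} (hvw : Submaj a v w)
    (hw_pos : ∀ t ∈ Ioa' a, 0 < w t)
    (hw_dec : ∀ s ∈ Ioa' a, ∀ t ∈ Ioa' a, s ≤ t → w t ≤ w s) {T : ℝ≥0∞} (hT : T ≤ a) :
    ∫⁻ x in Ioa' T, decRe a v x ≤ ∫⁻ x in Ioa' T, ENNReal.ofReal (w x) := by
  rcases eq_or_ne T 0 with rfl | hT0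
  · have : Ioa' 0 = ∅ := by ext; simp [Ioa']
    simp [this]
  obtain ⟨t, htm, ht, hU⟩ := exists_exhaustion (pos_iff_ne_zero.2 hT0)
  have hdir : Directed (· ⊆ ·) fun n => Ioo 0 (t n) :=
    Monotone.directed_le fun m n h => Ioo_subset_Ioo_right (htm h)
  nth_rewrite 1 [hU]
  rw [setLIntegral_iUnion_of_directed _ hdir]
  refine iSup_le fun n => (hvw _ (Ioa'_mono hT (ht n))).trans ?_
  have hsub : Ioo 0 (t n) ⊆ Ioa' T := by rw [hU]; exact subset_iUnion (fun n => Ioo 0 (t n)) n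
  calc ∫⁻ s in Ioo 0 (t n), decRe a w s ≤ ∫⁻ s in Ioo 0 (t n), ENNReal.ofReal (w s) :=
        setLIntegral_mono' measurableSet_Ioo fun x hx =>
          decRe_le_of_antitoneOn hw_pos hw_dec (Ioa'_mono hT (hsub hx))
    _ ≤ _ := lintegral_mono_set hsub

/-- Hardy's inequality: `∫ ψ(|g|) v ≤ ∫ ψ(g°) w` for `v ≺ w` and nondecreasing `ψ`. -/
lemma Submaj.lintegral_comp_mul_le {v g : ℝ → ℝ} {ψ : ℝ → ℝ} (hψ : Monotone ψ)
    (hv : Measurable v) (hv0 : ∀ t, 0 ≤ v t) (hvw : Submaj a v w) (hw : Measurable w)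
    (hw_pos : ∀ t ∈ Ioa' a, 0 < w t)
    (hw_dec : ∀ s ∈ Ioa' a, ∀ t ∈ Ioa' a, s ≤ t → w t ≤ w s)
    (hg : Measurable g) (hgfin : ∀ t ∈ Ioa' a, decRe a g t < ∞) :
    ∫⁻ t in Ioa' a, ENNReal.ofReal (v t) * ENNReal.ofReal (ψ |g t|) ≤
      ∫⁻ t in Ioa' a, ENNReal.ofReal (w t) * ENNReal.ofReal (ψ (decRe a g t).toReal) := by
  have hF1 : Measurable fun t => ENNReal.ofReal (ψ |g t|) :=
    (hψ.measurable.comp hg.abs).ennreal_ofReal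
  have hF2 : Measurable fun t => ENNReal.ofReal (ψ (decRe a g t).toReal) :=
    (hψ.measurable.comp (measurable_decRe a g).ennreal_toReal).ennreal_ofReal
  have e1 := lintegral_withDensity_eq_lintegral_mul (volume.restrict (Ioa' a))
    hv.ennreal_ofReal hF1
  have e2 := lintegral_withDensity_eq_lintegral_mul (volume.restrict (Ioa' a))
    hw.ennreal_ofReal hF2
  simp only [Pi.mul_apply] at e1 e2
  rw [← e1, ← e2, lintegral_eq_lintegral_measure_Ioa' hF1, lintegral_eq_lintegral_measure_Ioa' hF2]
  refine lintegral_mono fun s => ?_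
  rcases le_or_gt s 0 with hs | hs
  · have : {x | s ∈ Ioa' (ENNReal.ofReal (ψ |g x|))} = ∅ := by
      ext x; simp [Ioa', hs]
    simp [this]
  have m1 : MeasurableSet {x | s ∈ Ioa' (ENNReal.ofReal (ψ |g x|))} :=
    (MeasurableSet.const _).inter (measurableSet_lt measurable_const hF1)
  have m2 : MeasurableSet {x | s ∈ Ioa' (ENNReal.ofReal (ψ (decRe a g x).toReal))} :=
    (MeasurableSet.const _).inter (measurableSet_lt measurable_const hF2)
  rw [withDensity_apply _ m1, withDensity_apply _ m2, Measure.restrict_restrict m1,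
    Measure.restrict_restrict m2]
  set E := {x | s ∈ Ioa' (ENNReal.ofReal (ψ |g x|))} ∩ Ioa' a with hE
  have hEa : volume E ≤ a := (measure_mono inter_subset_right).trans_eq (volume_Ioa' a)
  calc ∫⁻ x in E, ENNReal.ofReal (v x) = ∫⁻ x in E, ENNReal.ofReal |v x| := by
        simp only [abs_of_nonneg (hv0 _)]
    _ ≤ ∫⁻ x in Ioa' (volume E), decRe a v x :=
        setLIntegral_le_lintegral_decRe hv inter_subset_right
    _ ≤ ∫⁻ x in Ioa' (volume E), ENNReal.ofReal (w x) := hvw.lintegral_le hw_pos hw_dec hEa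
    _ ≤ _ := by
        refine lintegral_mono_set fun x hx => ?_
        have hxI := Ioa'_mono hEa hx
        refine ⟨⟨hs, ?_⟩, hxI⟩
        rw [ENNReal.ofReal_lt_ofReal_iff_of_nonneg hs.le]
        by_contra! hc
        refine absurd hx.2 (not_lt.2 ?_)
        refine le_trans (measure_mono
          (show E ⊆ {y ∈ Ioa' a | (decRe a g x).toReal < |g y|} from fun y hy => ⟨hy.2, ?_⟩))
          (distr_decRe_le (hgfin x hxI))
        have h1 := (ENNReal.ofReal_lt_ofReal_iff_of_nonneg hs.le).1 hy.1.2
        by_contra! hc'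
        exact absurd ((hψ hc').trans hc) (not_le.2 h1)

/-- A criterion for submajorization by truncated integrals. -/
lemma submaj_of_lintegral_sub_le {v : ℝ → ℝ} (hv : Measurable v) (hv0 : ∀ t, 0 ≤ v t)
    (hw : Measurable w) (hw_pos : ∀ t ∈ Ioa' a, 0 < w t)
    (hw_dec : ∀ s ∈ Ioa' a, ∀ t ∈ Ioa' a, s ≤ t → w t ≤ w s)
    (h : ∀ s : ℝ, 0 ≤ s → ∫⁻ x in Ioa' a, ENNReal.ofReal (v x - s) ≤
      ∫⁻ x in Ioa' a, ENNReal.ofReal (w x - s)) : Submaj a v w := by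
  intro t ht
  have hs0 : 0 ≤ w t := (hw_pos t ht).le
  have htI : Ioo 0 t ⊆ Ioa' a := by rw [← Ioa'_ofReal]; exact Ioa'_mono ht.2.le
  have hvol : volume (Ioo 0 t) = ENNReal.ofReal t := by rw [Real.volume_Ioo, sub_zero]
  have h1 : ∫⁻ x in Ioo 0 t, (decRe a v x - ENNReal.ofReal (w t)) ≤
      ∫⁻ x in Ioa' a, ENNReal.ofReal (v x - w t) := by
    rw [lintegral_eq_lintegral_measure_Ioa' ((measurable_decRe a v).sub_const _),
      lintegral_eq_lintegral_measure_Ioa' (hv.sub_const _).ennreal_ofReal]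
    refine lintegral_mono fun s => ?_
    rcases le_or_gt s 0 with hs | hs
    · have : {x | s ∈ Ioa' (decRe a v x - ENNReal.ofReal (w t))} = ∅ := by
        ext x; simp [Ioa', hs]
      simp [this]
    have m1 : MeasurableSet {x | s ∈ Ioa' (ENNReal.ofReal (v x - w t))} :=
      (MeasurableSet.const _).inter
        (measurableSet_lt measurable_const (hv.sub_const _).ennreal_ofReal)
    have e1 : {x | s ∈ Ioa' (decRe a v x - ENNReal.ofReal (w t))} ∩ Ioo 0 t ⊆
        Ioa' (distr a v (s + w t)) := by
      rintro x ⟨⟨-, hx⟩, hx'⟩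
      refine ⟨hx'.1, ?_⟩
      rw [← ofReal_lt_decRe_iff (by positivity), ENNReal.ofReal_add hs.le hs0]
      exact lt_tsub_iff_right.1 hx
    rw [Measure.restrict_apply' measurableSet_Ioo, Measure.restrict_apply m1]
    refine (measure_mono e1).trans ((volume_Ioa' _).trans_le (measure_mono fun x hx => ?_))
    refine ⟨⟨hs, ?_⟩, hx.1⟩
    have h2 := hx.2
    rw [abs_of_nonneg (hv0 x)] at h2
    rw [ENNReal.ofReal_lt_ofReal_iff_of_nonneg hs.le]
    linarith
  calc ∫⁻ x in Ioo 0 t, decRe a v x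
      ≤ ∫⁻ x in Ioo 0 t, ((decRe a v x - ENNReal.ofReal (w t)) + ENNReal.ofReal (w t)) :=
        lintegral_mono fun x => le_tsub_add
    _ = (∫⁻ x in Ioo 0 t, (decRe a v x - ENNReal.ofReal (w t))) +
          ∫⁻ x in Ioo 0 t, ENNReal.ofReal (w t) := lintegral_add_right _ measurable_const
    _ ≤ (∫⁻ x in Ioa' a, ENNReal.ofReal (w x - w t)) + ∫⁻ x in Ioo 0 t, ENNReal.ofReal (w t) := by
        exact add_le_add (h1.trans (h _ hs0)) le_rfl
    _ = (∫⁻ x in Ioo 0 t, ENNReal.ofReal (w x - w t)) + ∫⁻ x in Ioo 0 t, ENNReal.ofReal (w t) := by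
        congr 1
        refine setLIntegral_eq_of_eq_zero (measurableSet_Ioa' a) measurableSet_Ioo htI ?_
        intro x hx hx'
        rw [ENNReal.ofReal_eq_zero, sub_nonpos]
        exact hw_dec t ht x hx (by by_contra! hc; exact hx' ⟨hx.1, hc⟩)
    _ = ∫⁻ x in Ioo 0 t, (ENNReal.ofReal (w x - w t) + ENNReal.ofReal (w t)) :=
        (lintegral_add_right _ measurable_const).symm
    _ ≤ ∫⁻ x in Ioo 0 t, ENNReal.ofReal |w x| := by
        refine setLIntegral_mono' measurableSet_Ioo fun x hx => ?_
        have := hw_dec x (htI hx) t ht hx.2.le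
        rw [← ENNReal.ofReal_add (by linarith) hs0]
        exact ENNReal.ofReal_le_ofReal (by linarith [le_abs_self (w x)])
    _ ≤ ∫⁻ x in Ioa' (volume (Ioo 0 t)), decRe a w x := setLIntegral_le_lintegral_decRe hw htI
    _ = ∫⁻ x in Ioo 0 t, decRe a w x := by rw [hvol, Ioa'_ofReal]

end Weight

section NFunction

variable {φ : ℝ → ℝ}

lemma IsNFn.monotoneOn (hφ : IsNFn φ) : MonotoneOn φ (Ici 0) := hφ.1.2.1.monotoneOn

lemma IsNFn.nonneg (hφ : IsNFn φ) {x : ℝ} (hx : 0 ≤ x) : 0 ≤ φ x := by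
  have := hφ.monotoneOn self_mem_Ici (mem_Ici.2 hx) hx
  rwa [hφ.1.2.2] at this

lemma IsNFn.map_mul_le (hφ : IsNFn φ) {c x : ℝ} (hc0 : 0 ≤ c) (hc1 : c ≤ 1) (hx : 0 ≤ x) :
    φ (c * x) ≤ c * φ x := by
  have := hφ.1.1.2 (mem_Ici.2 hx) self_mem_Ici hc0 (sub_nonneg.2 hc1) (by ring)
  simpa [hφ.1.2.2] using this

lemma IsNFn.measurable_comp (hφ : IsNFn φ) {f : ℝ → ℝ} (hf : Measurable f) (hf0 : ∀ t, 0 ≤ f t) :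
    Measurable fun t => φ (f t) := by
  have hm : Monotone fun x : ℝ => φ (max x 0) := fun x y hxy =>
    hφ.monotoneOn (mem_Ici.2 (le_max_right _ _)) (mem_Ici.2 (le_max_right _ _)) (max_le_max hxy le_rfl)
  have := hm.measurable.comp hf
  simpa only [Function.comp_def, max_eq_left (hf0 _)] using this

lemma IsNFn.exists_support_line (hφ : IsNFn φ) {x₀ : ℝ} (hx₀ : 0 ≤ x₀) :
    ∃ m : ℝ, 0 ≤ m ∧ ∀ x, 0 ≤ x → φ x₀ + m * x ≤ φ x + m * x₀ := by
  rcases hx₀.eq_or_lt with rfl | hpos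
  · exact ⟨0, le_rfl, fun x hx => by simpa [hφ.1.2.2] using hφ.nonneg hx⟩
  set S : Set ℝ := (fun x => (φ x - φ x₀) / (x - x₀)) '' Ioi x₀ with hS
  have hne : S.Nonempty := ⟨_, x₀ + 1, by simp, rfl⟩
  have hlow : ∀ y, 0 ≤ y → y < x₀ → ∀ z ∈ S, (φ x₀ - φ y) / (x₀ - y) ≤ z := by
    rintro y hy hyx _ ⟨x, hx, rfl⟩
    exact hφ.1.1.slope_mono_adjacent (mem_Ici.2 hy) (mem_Ici.2 (hx₀.trans hx.le)) hyx hx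
  refine ⟨sInf S, ?_, fun x hx => ?_⟩
  · refine le_csInf hne fun z hz => le_trans ?_ (hlow 0 le_rfl hpos z hz)
    rw [hφ.1.2.2, sub_zero, sub_zero]
    exact div_nonneg (hφ.nonneg hx₀) hx₀
  · rcases lt_trichotomy x x₀ with h | rfl | h
    · have h1 := le_csInf hne (hlow x hx h)
      rw [div_le_iff₀ (sub_pos.2 h)] at h1
      linarith
    · exact le_rfl
    · have h1 : sInf S ≤ (φ x - φ x₀) / (x - x₀) :=
        csInf_le ⟨_, fun z hz => hlow 0 le_rfl hpos z hz⟩ ⟨x, h, rfl⟩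
      rw [le_div_iff₀ (sub_pos.2 h)] at h1
      linarith

lemma IsNFn.exists_mul_le (hφ : IsNFn φ) (t : ℝ) : ∃ S : ℝ, 0 < S ∧ ∀ x, S ≤ x → x * t ≤ φ x := by
  obtain ⟨S, hS⟩ := eventually_atTop.1 (hφ.2.2.eventually_ge_atTop t)
  refine ⟨max S 1, by positivity, fun x hx => ?_⟩
  have hx0 : 0 < x := lt_of_lt_of_le (by positivity) hx
  have := hS x ((le_max_left _ _).trans hx)
  rwa [le_div_iff₀ hx0, mul_comm] at this

lemma IsNFn.exists_le_add (hφ : IsNFn φ) : ∃ C : ℝ, 0 ≤ C ∧ ∀ x, 0 ≤ x → x ≤ C + φ x := by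
  obtain ⟨S, hS, h⟩ := hφ.exists_mul_le 1
  refine ⟨S, hS.le, fun x hx => ?_⟩
  rcases le_total S x with hSx | hSx
  · linarith [h x hSx]
  · linarith [hφ.nonneg hx]

lemma IsNFn.continuousOn (hφ : IsNFn φ) : ContinuousOn φ (Ici 0) := by
  refine hφ.1.1.continuousOn_Ici ?_
  have hlin : Tendsto (fun s : ℝ => s * φ 1) (𝓝[≥] 0) (𝓝 0) := by
    have : Continuous fun s : ℝ => s * φ 1 := by fun_prop
    simpa using (this.tendsto 0).mono_left nhdsWithin_le_nhds
  rw [ContinuousWithinAt, hφ.1.2.2]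
  refine tendsto_of_tendsto_of_tendsto_of_le_of_le' tendsto_const_nhds hlin ?_ ?_
  · filter_upwards [self_mem_nhdsWithin] with s hs using hφ.nonneg hs
  · filter_upwards [self_mem_nhdsWithin, mem_nhdsWithin_of_mem_nhds (Iic_mem_nhds one_pos)]
      with s hs hs1
    simpa using hφ.map_mul_le hs hs1 zero_le_one

lemma IsNFn.exists_conjFn_eq (hφ : IsNFn φ) (t : ℝ) :
    ∃ s : ℝ, 0 ≤ s ∧ (∀ r, 0 ≤ r → r * t - φ r ≤ s * t - φ s) ∧ conjFn φ t = s * t - φ s := by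
  obtain ⟨S, hS, h⟩ := hφ.exists_mul_le t
  obtain ⟨s, hs, hmax⟩ := isCompact_Icc.exists_isMaxOn (nonempty_Icc.2 hS.le)
    (f := fun r => r * t - φ r)
    ((by fun_prop : ContinuousOn (fun r : ℝ => r * t) (Icc 0 S)).sub
      (hφ.continuousOn.mono Icc_subset_Ici_self))
  have hall : ∀ r, 0 ≤ r → r * t - φ r ≤ s * t - φ s := by
    intro r hr
    rcases le_total S r with hSr | hSr
    · have h0 := hmax (left_mem_Icc.2 hS.le)
      simp only [mem_ofPred_eq, zero_mul, hφ.1.2.2, sub_zero] at h0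
      linarith [h r hSr]
    · exact hmax ⟨hr, hSr⟩
  refine ⟨s, hs.1, hall, ?_⟩
  have hub : ∀ z ∈ (fun r => r * t - φ r) '' Ioi 0, z ≤ s * t - φ s := by
    rintro _ ⟨r, hr, rfl⟩
    exact hall r (le_of_lt hr)
  refine le_antisymm (csSup_le ⟨_, 1, mem_Ioi.2 one_pos, rfl⟩ hub) ?_
  rcases hs.1.eq_or_lt with rfl | hpos
  · rw [zero_mul, hφ.1.2.2, sub_zero]
    refine le_of_tendsto' (x := 𝓝[>] (0 : ℝ)) (f := fun r => if 0 < r then r * t - φ r else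
      conjFn φ t) ?_ fun r => ?_
    · have h1 : Tendsto (fun r => r * t - φ r) (𝓝[>] 0) (𝓝 (0 * t - φ 0)) :=
        ((by fun_prop : ContinuousOn (fun r : ℝ => r * t) (Ici 0)).sub hφ.continuousOn 0
          self_mem_Ici).mono_left (nhdsWithin_mono _ Ioi_subset_Ici_self)
      rw [zero_mul, hφ.1.2.2, sub_zero] at h1
      refine h1.congr' ?_
      filter_upwards [self_mem_nhdsWithin] with r hr
      rw [if_pos (mem_Ioi.1 hr)]
    · split_ifs with hr
      · exact le_csSup ⟨_, hub⟩ ⟨r, hr, rfl⟩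
      · exact le_rfl
  · exact le_csSup ⟨_, hub⟩ ⟨s, hpos, rfl⟩

/-- Young's inequality. -/
lemma IsNFn.mul_le_add_conjFn (hφ : IsNFn φ) {s : ℝ} (hs : 0 ≤ s) (t : ℝ) :
    s * t ≤ φ s + conjFn φ t := by
  obtain ⟨r, -, hr, h⟩ := hφ.exists_conjFn_eq t
  linarith [hr s hs]

lemma IsNFn.conjFn_nonneg (hφ : IsNFn φ) (t : ℝ) : 0 ≤ conjFn φ t := by
  have := hφ.mul_le_add_conjFn le_rfl t
  simpa [hφ.1.2.2] using this

lemma IsNFn.conjFn_monotone (hφ : IsNFn φ) : Monotone (conjFn φ) := by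
  intro t u htu
  obtain ⟨r, hr0, -, h⟩ := hφ.exists_conjFn_eq t
  rw [h]
  linarith [hφ.mul_le_add_conjFn hr0 u, mul_le_mul_of_nonneg_left htu hr0]

/-- A nondecreasing selection of maximizers in the definition of the complementary function. -/
lemma IsNFn.exists_monotone_selection (hφ : IsNFn φ) :
    ∃ σ : ℝ → ℝ, Monotone σ ∧ (∀ t, 0 ≤ σ t) ∧ ∀ t, conjFn φ t = σ t * t - φ (σ t) := by
  choose σ hσ0 hσ hσeq using hφ.exists_conjFn_eq
  refine ⟨σ, fun t u htu => ?_, hσ0, hσeq⟩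
  rcases htu.eq_or_lt with rfl | hlt
  · exact le_rfl
  · have h1 := hσ t _ (hσ0 u)
    have h2 := hσ u _ (hσ0 t)
    by_contra! hc
    nlinarith [mul_pos (sub_pos.2 hc) (sub_pos.2 hlt)]

end NFunction

/-- A positive nonincreasing weight on `(0,a)` with finite primitive. -/
structure IsWeight (a : ℝ≥0∞) (w : ℝ → ℝ) : Prop where
  meas : Measurable w
  pos : ∀ t ∈ Ioa' a, 0 < w t
  anti : ∀ s ∈ Ioa' a, ∀ t ∈ Ioa' a, s ≤ t → w t ≤ w s
  fin : ∀ t ∈ Ioa' a, ∫⁻ s in Ioo 0 t, ENNReal.ofReal (w s) < ∞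

lemma otermE_ofReal_abs (φ : ℝ → ℝ) (c v : ℝ) :
    otermE φ (ENNReal.ofReal |c|) v = oterm φ |c| v := by
  simp [otermE]

section Perspective

variable {φ : ℝ → ℝ} {c v : ℝ}

lemma oterm_of_pos (hv : 0 < v) : oterm φ c v = ENNReal.ofReal (φ (c / v) * v) := by
  simp [oterm, hv.ne']

lemma IsNFn.ofReal_mul_le_oterm (hφ : IsNFn φ) (hc : 0 ≤ c) (hv : 0 ≤ v) (t : ℝ) :
    ENNReal.ofReal (c * t) ≤ oterm φ c v + ENNReal.ofReal v * ENNReal.ofReal (conjFn φ t) := by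
  rcases hv.eq_or_lt with rfl | hv'
  · by_cases h : c = 0 <;> simp [oterm, h]
  · have h1 := hφ.mul_le_add_conjFn (div_nonneg hc hv) t
    rw [oterm_of_pos hv', ← ENNReal.ofReal_mul hv, ← ENNReal.ofReal_add
      (mul_nonneg (hφ.nonneg (div_nonneg hc hv)) hv) (mul_nonneg hv (hφ.conjFn_nonneg t))]
    refine ENNReal.ofReal_le_ofReal ?_
    have h2 := mul_le_mul_of_nonneg_right h1 hv
    have h3 : c / v * t * v = c * t := by field_simp
    nlinarith

lemma oterm_add_le {x₀ m : ℝ} (hx₀ : 0 ≤ x₀) (hm : 0 ≤ m) (hφ : IsNFn φ)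
    (h : ∀ x, 0 ≤ x → φ x₀ + m * x ≤ φ x + m * x₀) (hc : 0 ≤ c) (hv : 0 ≤ v) :
    ENNReal.ofReal (φ x₀) * ENNReal.ofReal v + ENNReal.ofReal m * ENNReal.ofReal c ≤
      oterm φ c v + ENNReal.ofReal (m * x₀) * ENNReal.ofReal v := by
  rcases hv.eq_or_lt with rfl | hv'
  · by_cases h : c = 0 <;> simp [oterm, h]
  · have hd := div_nonneg hc hv
    rw [oterm_of_pos hv', ← ENNReal.ofReal_mul (hφ.nonneg hx₀), ← ENNReal.ofReal_mul hm,
      ← ENNReal.ofReal_mul (by positivity),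
      ← ENNReal.ofReal_add (mul_nonneg (hφ.nonneg hx₀) hv) (by positivity),
      ← ENNReal.ofReal_add (mul_nonneg (hφ.nonneg hd) hv) (by positivity)]
    refine ENNReal.ofReal_le_ofReal ?_
    have h2 := mul_le_mul_of_nonneg_right (h _ hd) hv
    have h3 : m * (c / v) * v = m * c := by field_simp
    nlinarith

lemma oterm_le_add {C : ℝ} (hC : 0 ≤ C) (hφ : IsNFn φ) (h : ∀ x, 0 ≤ x → x ≤ C + φ x)
    (hc : 0 ≤ c) (hv : 0 ≤ v) :
    ENNReal.ofReal c ≤ ENNReal.ofReal C * ENNReal.ofReal v + oterm φ c v := by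
  rcases hv.eq_or_lt with rfl | hv'
  · by_cases h : c = 0 <;> simp [oterm, h]
  · have hd := div_nonneg hc hv
    rw [oterm_of_pos hv', ← ENNReal.ofReal_mul hC,
      ← ENNReal.ofReal_add (by positivity) (mul_nonneg (hφ.nonneg hd) hv)]
    refine ENNReal.ofReal_le_ofReal ?_
    have h2 := mul_le_mul_of_nonneg_right (h _ hd) hv
    have h3 : (c / v) * v = c := by field_simp
    nlinarith

end Perspective

section Duality

variable {a : ℝ≥0∞} {w φ g : ℝ → ℝ}

/-- Young's inequality for the pairing of `𝓜_{φ,w}` with `Λ_{φ*,w}`. -/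
lemma IsWeight.lintegral_mul_le (hw : IsWeight a w) (hφ : IsNFn φ) (hg : Measurable g)
    (hgfin : ∀ t ∈ Ioa' a, decRe a g t < ∞) {h v : ℝ → ℝ} (hv : Measurable v)
    (hv0 : ∀ t, 0 ≤ v t) (hvw : Submaj a v w) {k : ℝ} (hk : 0 < k) :
    ENNReal.ofReal k * ∫⁻ t in Ioa' a, ENNReal.ofReal |g t * h t| ≤
      (∫⁻ t in Ioa' a, otermE φ (ENNReal.ofReal |h t|) (v t)) +
        ∫⁻ t in Ioa' a, ENNReal.ofReal (w t) *
          ENNReal.ofReal (conjFn φ (k * (decRe a g t).toReal)) := by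
  have hψ : Monotone fun x => conjFn φ (k * x) := fun x y hxy =>
    hφ.conjFn_monotone (mul_le_mul_of_nonneg_left hxy hk.le)
  refine le_trans ?_ (add_le_add le_rfl
    (hvw.lintegral_comp_mul_le hψ hv hv0 hw.meas hw.pos hw.anti hg hgfin))
  rw [← lintegral_const_mul' _ _ ENNReal.ofReal_ne_top, ← lintegral_add_right]
  · refine lintegral_mono fun t => ?_
    have := hφ.ofReal_mul_le_oterm (abs_nonneg (h t)) (hv0 t) (k * |g t|)
    rw [otermE_ofReal_abs, ← ENNReal.ofReal_mul hk.le, abs_mul]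
    convert this using 2
    ring
  · exact hv.ennreal_ofReal.mul (hψ.measurable.comp hg.abs).ennreal_ofReal

/-- The modular of the weighted Orlicz space `L_φ(w)`. -/
def orliczMod (a : ℝ≥0∞) (φ w f : ℝ → ℝ) : ℝ≥0∞ :=
  ∫⁻ t in Ioa' a, ENNReal.ofReal (φ (f t) * w t)

/-- The pairing `∫ g° f w`. -/
def decPair (a : ℝ≥0∞) (w g f : ℝ → ℝ) : ℝ≥0∞ :=
  ∫⁻ t in Ioa' a, decRe a g t * ENNReal.ofReal (f t * w t)

lemma measurable_decPair_integrand (hw : Measurable w) {f : ℝ → ℝ} (hf : Measurable f) :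
    Measurable fun t => decRe a g t * ENNReal.ofReal (f t * w t) :=
  (measurable_decRe a g).mul (hf.mul hw).ennreal_ofReal

lemma decPair_const_mul (c : ℝ) (hc : 0 ≤ c) (f : ℝ → ℝ) :
    decPair a w g (fun t => c * f t) = ENNReal.ofReal c * decPair a w g f := by
  rw [decPair, decPair, ← lintegral_const_mul' _ _ ENNReal.ofReal_ne_top]
  refine lintegral_congr fun t => ?_
  rw [mul_assoc, ENNReal.ofReal_mul hc]
  ring

lemma IsWeight.decPair_add (hw : IsWeight a w) {f₁ f₂ : ℝ → ℝ} (h₁ : Measurable f₁)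
    (h₁0 : ∀ t, 0 ≤ f₁ t) (h₂0 : ∀ t, 0 ≤ f₂ t) :
    decPair a w g (fun t => f₁ t + f₂ t) = decPair a w g f₁ + decPair a w g f₂ := by
  rw [decPair, decPair, decPair, ← lintegral_add_left (measurable_decPair_integrand hw.meas h₁)]
  refine setLIntegral_congr_fun (measurableSet_Ioa' a) fun t ht => ?_
  have := (hw.pos t ht).le
  simp only [add_mul]
  rw [ENNReal.ofReal_add (mul_nonneg (h₁0 t) this) (mul_nonneg (h₂0 t) this), mul_add]

lemma IsWeight.orliczMod_const_mul_le (hw : IsWeight a w) (hφ : IsNFn φ) {c : ℝ} (hc : 0 ≤ c)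
    (hc1 : c ≤ 1) {f : ℝ → ℝ} (hf0 : ∀ t, 0 ≤ f t) :
    orliczMod a φ w (fun t => c * f t) ≤ ENNReal.ofReal c * orliczMod a φ w f := by
  rw [orliczMod, orliczMod, ← lintegral_const_mul' _ _ ENNReal.ofReal_ne_top]
  refine setLIntegral_mono' (measurableSet_Ioa' a) fun t ht => ?_
  rw [← ENNReal.ofReal_mul hc, ← mul_assoc]
  exact ENNReal.ofReal_le_ofReal
    (mul_le_mul_of_nonneg_right (hφ.map_mul_le hc hc1 (hf0 t)) (hw.pos t ht).le)

lemma IsWeight.orliczMod_combo_le (hw : IsWeight a w) (hφ : IsNFn φ) {α β : ℝ} (hα : 0 ≤ α)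
    (hβ : 0 ≤ β) (hαβ : α + β = 1) {f₁ f₂ : ℝ → ℝ} (h₁ : Measurable f₁)
    (h₁0 : ∀ t, 0 ≤ f₁ t) (h₂0 : ∀ t, 0 ≤ f₂ t) :
    orliczMod a φ w (fun t => α * f₁ t + β * f₂ t) ≤
      ENNReal.ofReal α * orliczMod a φ w f₁ + ENNReal.ofReal β * orliczMod a φ w f₂ := by
  rw [orliczMod, orliczMod, orliczMod, ← lintegral_const_mul' _ _ ENNReal.ofReal_ne_top,
    ← lintegral_const_mul' _ _ ENNReal.ofReal_ne_top, ← lintegral_add_left]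
  · refine setLIntegral_mono' (measurableSet_Ioa' a) fun t ht => ?_
    have hwt := (hw.pos t ht).le
    have n1 := hφ.nonneg (h₁0 t)
    have n2 := hφ.nonneg (h₂0 t)
    rw [← ENNReal.ofReal_mul hα, ← ENNReal.ofReal_mul hβ,
      ← ENNReal.ofReal_add (by positivity) (by positivity)]
    refine ENNReal.ofReal_le_ofReal ?_
    have := hφ.1.1.2 (mem_Ici.2 (h₁0 t)) (mem_Ici.2 (h₂0 t)) hα hβ hαβ
    simp only [smul_eq_mul] at this
    nlinarith [mul_le_mul_of_nonneg_right this hwt]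
  · exact ((hφ.measurable_comp h₁ h₁0).mul hw.meas).ennreal_ofReal.const_mul _

/-- Strong duality: a bound `V` for the pairing on the unit ball gives a Lagrange multiplier. -/
lemma IsWeight.exists_multiplier (hw : IsWeight a w) (hφ : IsNFn φ) {V : ℝ} (hV0 : 0 ≤ V)
    (hV : ∀ f : ℝ → ℝ, Measurable f → (∀ t, 0 ≤ f t) → orliczMod a φ w f ≤ 1 →
      decPair a w g f ≤ ENNReal.ofReal V) :
    ∃ l : ℝ, 0 ≤ l ∧ ∀ f : ℝ → ℝ, Measurable f → (∀ t, 0 ≤ f t) → orliczMod a φ w f < ∞ →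
      decPair a w g f < ∞ ∧
      (decPair a w g f).toReal ≤ V + l * ((orliczMod a φ w f).toReal - 1) := by
  have hfin : ∀ f : ℝ → ℝ, Measurable f → (∀ t, 0 ≤ f t) → orliczMod a φ w f < ∞ →
      decPair a w g f < ∞ := by
    intro f hf hf0 hM
    set y := max 1 (orliczMod a φ w f).toReal with hy
    have hy1 : 1 ≤ y := le_max_left _ _
    have hy0 : 0 < y := one_pos.trans_le hy1
    have h1 : orliczMod a φ w (fun t => y⁻¹ * f t) ≤ 1 := by
      refine (hw.orliczMod_const_mul_le hφ (by positivity) (inv_le_one_of_one_le₀ hy1) hf0).trans ?_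
      rw [← ENNReal.ofReal_toReal hM.ne, ← ENNReal.ofReal_mul (by positivity),
        ENNReal.ofReal_le_one, inv_mul_le_one₀ hy0]
      exact le_max_right _ _
    have h2 := hV _ (hf.const_mul _) (fun t => mul_nonneg (by positivity) (hf0 t)) h1
    rw [decPair_const_mul _ (by positivity)] at h2
    by_contra! hc
    rw [top_le_iff.1 hc, ENNReal.mul_top (by simpa using hy0), top_le_iff] at h2
    exact ENNReal.ofReal_ne_top h2
  have hball : ∀ f : ℝ → ℝ, Measurable f → (∀ t, 0 ≤ f t) → orliczMod a φ w f < ∞ →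
      (orliczMod a φ w f).toReal ≤ 1 → (decPair a w g f).toReal ≤ V := by
    intro f hf hf0 hM hM1
    refine ENNReal.toReal_le_of_le_ofReal hV0 (hV f hf hf0 ?_)
    rw [← ENNReal.ofReal_toReal hM.ne, ENNReal.ofReal_le_one]
    exact hM1
  have hkey : ∀ f₁ : ℝ → ℝ, Measurable f₁ → (∀ t, 0 ≤ f₁ t) → orliczMod a φ w f₁ < ∞ →
      (orliczMod a φ w f₁).toReal < 1 → ∀ f₂ : ℝ → ℝ, Measurable f₂ → (∀ t, 0 ≤ f₂ t) →
      orliczMod a φ w f₂ < ∞ → 1 < (orliczMod a φ w f₂).toReal →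
      ((decPair a w g f₂).toReal - V) / ((orliczMod a φ w f₂).toReal - 1) ≤
        (V - (decPair a w g f₁).toReal) / (1 - (orliczMod a φ w f₁).toReal) := by
    intro f₁ m₁ p₁ t₁ l₁ f₂ m₂ p₂ t₂ l₂
    set M₁ := (orliczMod a φ w f₁).toReal with hM₁
    set M₂ := (orliczMod a φ w f₂).toReal with hM₂
    have hd : 0 < M₂ - M₁ := by linarith
    set α := (M₂ - 1) / (M₂ - M₁) with hα
    set β := (1 - M₁) / (M₂ - M₁) with hβ
    have hα0 : 0 ≤ α := div_nonneg (by linarith) hd.le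
    have hβ0 : 0 ≤ β := div_nonneg (by linarith) hd.le
    have hαβ : α + β = 1 := by rw [hα, hβ]; field_simp; ring
    have hM : α * M₁ + β * M₂ = 1 := by rw [hα, hβ]; field_simp; ring
    have hle := hw.orliczMod_combo_le hφ hα0 hβ0 hαβ m₁ p₁ p₂
    rw [← ENNReal.ofReal_toReal t₁.ne, ← ENNReal.ofReal_toReal t₂.ne, ← ENNReal.ofReal_mul hα0,
      ← ENNReal.ofReal_mul hβ0, ← ENNReal.ofReal_add (by positivity) (by positivity), ← hM₁, ← hM₂,
      hM, ENNReal.ofReal_one] at hle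
    have hJ := hV _ ((m₁.const_mul α).add (m₂.const_mul β)) (fun t => add_nonneg
      (mul_nonneg hα0 (p₁ t)) (mul_nonneg hβ0 (p₂ t))) hle
    have hJ' : decPair a w g (fun t => α * f₁ t + β * f₂ t) =
        ENNReal.ofReal α * decPair a w g f₁ + ENNReal.ofReal β * decPair a w g f₂ := by
      rw [hw.decPair_add (m₁.const_mul α) (fun t => mul_nonneg hα0 (p₁ t))
        (fun t => mul_nonneg hβ0 (p₂ t)), decPair_const_mul α hα0, decPair_const_mul β hβ0]
    have hJ2 : decPair a w g (fun t => α * f₁ t + β * f₂ t) ≤ ENNReal.ofReal V := hJ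
    rw [hJ', ← ENNReal.ofReal_toReal (hfin f₁ m₁ p₁ t₁).ne,
      ← ENNReal.ofReal_toReal (hfin f₂ m₂ p₂ t₂).ne, ← ENNReal.ofReal_mul hα0,
      ← ENNReal.ofReal_mul hβ0, ← ENNReal.ofReal_add (by positivity) (by positivity),
      ENNReal.ofReal_le_ofReal_iff hV0, hα, hβ, div_mul_eq_mul_div, div_mul_eq_mul_div,
      ← add_div, div_le_iff₀ hd] at hJ2
    rw [div_le_div_iff₀ (by linarith) (by linarith)]
    nlinarith
  set S : Set ℝ := {z | ∃ f : ℝ → ℝ, Measurable f ∧ (∀ t, 0 ≤ f t) ∧ orliczMod a φ w f < ∞ ∧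
    1 < (orliczMod a φ w f).toReal ∧
    z = ((decPair a w g f).toReal - V) / ((orliczMod a φ w f).toReal - 1)} with hS
  have hz : orliczMod a φ w (fun _ => 0) = 0 := by simp [orliczMod, hφ.1.2.2]
  have hub : ∀ f₁ : ℝ → ℝ, Measurable f₁ → (∀ t, 0 ≤ f₁ t) → orliczMod a φ w f₁ < ∞ →
      (orliczMod a φ w f₁).toReal < 1 → ∀ z ∈ S,
      z ≤ (V - (decPair a w g f₁).toReal) / (1 - (orliczMod a φ w f₁).toReal) := by
    rintro f₁ m₁ p₁ t₁ l₁ _ ⟨f₂, m₂, p₂, t₂, l₂, rfl⟩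
    exact hkey f₁ m₁ p₁ t₁ l₁ f₂ m₂ p₂ t₂ l₂
  have hbdd : BddAbove S := ⟨_, hub (fun _ => 0) measurable_const (fun _ => le_rfl)
    (by rw [hz]; exact ENNReal.zero_lt_top) (by rw [hz]; simp)⟩
  refine ⟨max 0 (sSup S), le_max_left _ _, fun f hf hf0 hM => ⟨hfin f hf hf0 hM, ?_⟩⟩
  rcases lt_trichotomy (orliczMod a φ w f).toReal 1 with h | h | h
  · have hle : max 0 (sSup S) ≤
        (V - (decPair a w g f).toReal) / (1 - (orliczMod a φ w f).toReal) := by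
      have h0 : 0 ≤ (V - (decPair a w g f).toReal) / (1 - (orliczMod a φ w f).toReal) :=
        div_nonneg (by linarith [hball f hf hf0 hM h.le]) (by linarith)
      exact max_le h0 (Real.sSup_le (hub f hf hf0 hM h) h0)
    rw [le_div_iff₀ (by linarith)] at hle
    linarith
  · rw [h, sub_self, mul_zero, add_zero]
    exact hball f hf hf0 hM h.le
  · have hle : ((decPair a w g f).toReal - V) / ((orliczMod a φ w f).toReal - 1) ≤
        max 0 (sSup S) :=
      (le_csSup hbdd ⟨f, hf, hf0, hM, h, rfl⟩).trans (le_max_right _ _)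
    rw [div_le_iff₀ (by linarith)] at hle
    linarith

end Duality

section Multiplier

variable {a : ℝ≥0∞} {w φ g : ℝ → ℝ}

lemma Ioo_subset_Ioa' {t : ℝ} (ht : t ∈ Ioa' a) : Ioo 0 t ⊆ Ioa' a := fun _ hx =>
  ⟨hx.1, (ENNReal.ofReal_le_ofReal hx.2.le).trans_lt ht.2⟩

/-- If the pairing with `g°` is bounded on the unit ball of `L_φ(w)`, then `g°` is finite. -/
lemma IsWeight.decRe_lt_top (hw : IsWeight a w) (hφ : IsNFn φ) {V : ℝ}
    (hV : ∀ f : ℝ → ℝ, Measurable f → (∀ t, 0 ≤ f t) → orliczMod a φ w f ≤ 1 →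
      decPair a w g f ≤ ENNReal.ofReal V) : ∀ t ∈ Ioa' a, decRe a g t < ∞ := by
  intro t ht
  by_contra! hc
  rw [top_le_iff] at hc
  have hsub := Ioo_subset_Ioa' ht
  set W := (∫⁻ s in Ioo 0 t, ENNReal.ofReal (w s)).toReal with hW
  have hW0 : 0 ≤ W := ENNReal.toReal_nonneg
  have hφ1 : 0 ≤ φ 1 := hφ.nonneg zero_le_one
  set c := (1 + φ 1 * W)⁻¹ with hcdef
  have hc0 : 0 < c := by positivity
  have hc1 : c ≤ 1 := inv_le_one_of_one_le₀ (by nlinarith [mul_nonneg hφ1 hW0])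
  set f : ℝ → ℝ := (Ioo 0 t).indicator fun _ => c with hf
  have hfm : Measurable f := measurable_const.indicator measurableSet_Ioo
  have hf0 : ∀ x, 0 ≤ f x := fun x => indicator_nonneg (fun _ _ => hc0.le) x
  have hM : orliczMod a φ w f ≤ 1 := by
    rw [orliczMod, setLIntegral_eq_of_eq_zero (measurableSet_Ioa' a) measurableSet_Ioo hsub]
    · calc ∫⁻ x in Ioo 0 t, ENNReal.ofReal (φ (f x) * w x)
          ≤ ∫⁻ x in Ioo 0 t, ENNReal.ofReal (c * φ 1) * ENNReal.ofReal (w x) := by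
            refine setLIntegral_mono' measurableSet_Ioo fun x hx => ?_
            rw [← ENNReal.ofReal_mul (by positivity), hf, indicator_of_mem hx]
            refine ENNReal.ofReal_le_ofReal (mul_le_mul_of_nonneg_right ?_ (hw.pos x (hsub hx)).le)
            simpa using hφ.map_mul_le hc0.le hc1 zero_le_one
        _ = ENNReal.ofReal (c * φ 1 * W) := by
            rw [lintegral_const_mul' _ _ ENNReal.ofReal_ne_top,
              ENNReal.ofReal_mul (by positivity : 0 ≤ c * φ 1), hW,
              ENNReal.ofReal_toReal (hw.fin t ht).ne]
        _ ≤ 1 := by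
            rw [ENNReal.ofReal_le_one, hcdef, mul_assoc, inv_mul_le_one₀ (by positivity)]
            linarith
    · intro x _ hx
      simp [hf, hx, hφ.1.2.2]
  have hJ := hV f hfm hf0 hM
  have htop : decPair a w g f = ∞ := by
    rw [← top_le_iff]
    calc (∞ : ℝ≥0∞) = ∫⁻ _ in Ioo 0 t, ∞ := by
            rw [setLIntegral_const, Real.volume_Ioo, ENNReal.top_mul]
            simpa using ht.1
      _ ≤ ∫⁻ x in Ioo 0 t, decRe a g x * ENNReal.ofReal (f x * w x) := by
            refine setLIntegral_mono' measurableSet_Ioo fun x hx => ?_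
            have h1 : decRe a g x = ∞ := top_le_iff.1 (hc ▸ decRe_anti a g hx.2.le)
            rw [h1, ENNReal.top_mul]
            rw [hf, indicator_of_mem hx]
            simpa using mul_pos hc0 (hw.pos x (hsub hx))
      _ ≤ _ := lintegral_mono_set hsub
  rw [htop, top_le_iff] at hJ
  exact ENNReal.ofReal_ne_top hJ

/-- The Amemiya form of the Orlicz norm is attained up to `ε`. -/
lemma IsWeight.exists_amemiya_le (hw : IsWeight a w) (ha : 0 < a) (hφ : IsNFn φ) {V : ℝ}
    (hV0 : 0 ≤ V)
    (hV : ∀ f : ℝ → ℝ, Measurable f → (∀ t, 0 ≤ f t) → orliczMod a φ w f ≤ 1 →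
      decPair a w g f ≤ ENNReal.ofReal V) {ε : ℝ} (hε : 0 < ε) :
    ∃ l : ℝ, 0 < l ∧ ENNReal.ofReal l * (1 + ∫⁻ t in Ioa' a, ENNReal.ofReal (w t) *
      ENNReal.ofReal (conjFn φ (l⁻¹ * (decRe a g t).toReal))) ≤ ENNReal.ofReal (V + ε) := by
  have hgfin := hw.decRe_lt_top hφ hV
  obtain ⟨l, hl0, hl⟩ := hw.exists_multiplier hφ hV0 hV
  obtain ⟨σ, hσm, hσ0, hσ⟩ := hφ.exists_monotone_selection
  set L := l + ε with hL
  have hL0 : 0 < L := by positivity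
  set k := L⁻¹ with hk
  have hk0 : 0 < k := by positivity
  set s : ℝ → ℝ := fun x => σ (k * (decRe a g x).toReal) with hs
  have hsm : Measurable s := hσm.measurable.comp ((measurable_decRe a g).ennreal_toReal.const_mul k)
  have hs0 : ∀ x, 0 ≤ s x := fun x => hσ0 _
  obtain ⟨t, htm, ht, hIt⟩ := exists_exhaustion ha
  set E : ℕ → Set ℝ := fun n => Ioo (1 / ((n : ℝ) + 1)) (t n) with hE
  have hepos : ∀ n : ℕ, 0 < 1 / ((n : ℝ) + 1) := fun n => by positivity
  have hEsub : ∀ n, E n ⊆ Ioa' a := fun n x hx =>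
    Ioo_subset_Ioa' (ht n) ⟨(hepos n).trans hx.1, hx.2⟩
  have hEU : Ioa' a = ⋃ n, E n := by
    refine Subset.antisymm (fun x hx => ?_) (iUnion_subset hEsub)
    rw [hIt] at hx
    obtain ⟨n, hn⟩ := mem_iUnion.1 hx
    obtain ⟨m, hm⟩ := exists_nat_one_div_lt hn.1
    refine mem_iUnion.2 ⟨max n m, ?_, hn.2.trans_le (htm (le_max_left _ _))⟩
    refine lt_of_le_of_lt (one_div_le_one_div_of_le (by positivity) ?_) hm
    have : (m : ℝ) ≤ (max n m : ℕ) := by exact_mod_cast le_max_right _ _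
    linarith
  have hEmono : Monotone E := fun n m hnm => Ioo_subset_Ioo
    (one_div_le_one_div_of_le (by positivity) (by
      have : (n : ℝ) ≤ m := by exact_mod_cast hnm
      linarith)) (htm hnm)
  set F : ℝ → ℝ≥0∞ := fun x => ENNReal.ofReal (w x) *
    ENNReal.ofReal (conjFn φ (k * (decRe a g x).toReal)) with hF
  have hbound : ∀ n, ∫⁻ x in E n, F x ≤ ENNReal.ofReal (k * (V + ε) - 1) ∧
      0 ≤ k * (V + ε) - 1 := by
    intro n
    set f : ℝ → ℝ := (E n).indicator s with hf
    have hfm : Measurable f := hsm.indicator measurableSet_Ioo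
    have hf0 : ∀ x, 0 ≤ f x := fun x => indicator_nonneg (fun _ _ => hs0 _) x
    have hfE : ∀ x ∈ E n, f x = s x := fun x hx => indicator_of_mem hx s
    have hfE' : ∀ x ∉ E n, f x = 0 := fun x hx => indicator_of_notMem hx s
    have hM : orliczMod a φ w f = ∫⁻ x in E n, ENNReal.ofReal (φ (s x) * w x) := by
      rw [orliczMod, setLIntegral_eq_of_eq_zero (measurableSet_Ioa' a) measurableSet_Ioo (hEsub n)]
      · refine setLIntegral_congr_fun measurableSet_Ioo fun x hx => ?_
        simp only [hfE x hx]
      · intro x _ hx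
        simp [hfE' x hx, hφ.1.2.2]
    have hJ : decPair a w g f = ∫⁻ x in E n, decRe a g x * ENNReal.ofReal (s x * w x) := by
      rw [decPair, setLIntegral_eq_of_eq_zero (measurableSet_Ioa' a) measurableSet_Ioo (hEsub n)]
      · refine setLIntegral_congr_fun measurableSet_Ioo fun x hx => ?_
        simp only [hfE x hx]
      · intro x _ hx
        simp [hfE' x hx]
    have hMfin : orliczMod a φ w f < ∞ := by
      set B := φ (σ (k * (decRe a g (1 / ((n : ℝ) + 1))).toReal)) with hB
      have hB0 : 0 ≤ B := hφ.nonneg (hσ0 _)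
      rw [hM]
      calc ∫⁻ x in E n, ENNReal.ofReal (φ (s x) * w x)
          ≤ ∫⁻ x in E n, ENNReal.ofReal B * ENNReal.ofReal (w x) := by
            refine setLIntegral_mono' measurableSet_Ioo fun x hx => ?_
            rw [← ENNReal.ofReal_mul hB0]
            refine ENNReal.ofReal_le_ofReal
              (mul_le_mul_of_nonneg_right ?_ (hw.pos x (hEsub n hx)).le)
            refine hφ.monotoneOn (mem_Ici.2 (hs0 x)) (mem_Ici.2 (hσ0 _)) (hσm ?_)
            refine mul_le_mul_of_nonneg_left ?_ hk0.le
            exact ENNReal.toReal_mono (hgfin _ ⟨hepos n, (ENNReal.ofReal_le_ofReal hx.1.le).trans_lt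
              (hEsub n hx).2⟩).ne (decRe_anti a g hx.1.le)
        _ ≤ ∫⁻ x in Ioo 0 (t n), ENNReal.ofReal B * ENNReal.ofReal (w x) :=
            lintegral_mono_set (Ioo_subset_Ioo_left (hepos n).le)
        _ < ∞ := by
            rw [lintegral_const_mul' _ _ ENNReal.ofReal_ne_top]
            exact ENNReal.mul_lt_top ENNReal.ofReal_lt_top (hw.fin _ (ht n))
    obtain ⟨hJfin, hJle⟩ := hl f hfm hf0 hMfin
    have hsum : (∫⁻ x in E n, F x) + orliczMod a φ w f =
        ENNReal.ofReal k * decPair a w g f := by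
      have hmeas : Measurable fun x => ENNReal.ofReal (φ (s x) * w x) :=
        ((hφ.measurable_comp hsm hs0).mul hw.meas).ennreal_ofReal
      rw [hM, hJ, ← lintegral_const_mul' _ _ ENNReal.ofReal_ne_top, ← lintegral_add_right _ hmeas]
      refine setLIntegral_congr_fun measurableSet_Ioo fun x (hx : x ∈ E n) => ?_
      have hwx := (hw.pos x (hEsub n hx)).le
      have hgx := hgfin x (hEsub n hx)
      have hσx := hσ (k * (decRe a g x).toReal)
      simp only [hF]
      rw [← ENNReal.ofReal_mul hwx, ← ENNReal.ofReal_add (mul_nonneg hwx (hφ.conjFn_nonneg _))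
        (mul_nonneg (hφ.nonneg (hs0 x)) hwx)]
      conv_rhs => rw [← ENNReal.ofReal_toReal hgx.ne]
      rw [← ENNReal.ofReal_mul ENNReal.toReal_nonneg, ← ENNReal.ofReal_mul hk0.le, hσx]
      congr 1
      simp only [hs]
      ring
    have hAfin : ∫⁻ x in E n, F x < ∞ := lt_of_le_of_lt le_self_add
      (hsum ▸ ENNReal.mul_lt_top ENNReal.ofReal_lt_top hJfin)
    have hreal := congrArg ENNReal.toReal hsum
    rw [ENNReal.toReal_add hAfin.ne hMfin.ne, ENNReal.toReal_mul,
      ENNReal.toReal_ofReal hk0.le] at hreal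
    have hM0 : 0 ≤ (orliczMod a φ w f).toReal := ENNReal.toReal_nonneg
    have hA0 : 0 ≤ (∫⁻ x in E n, F x).toReal := ENNReal.toReal_nonneg
    have hJ' : k * (decPair a w g f).toReal ≤
        k * (V + ε) + ((orliczMod a φ w f).toReal - 1) := by
      have h1 : (decPair a w g f).toReal ≤ V + ε + L * ((orliczMod a φ w f).toReal - 1) := by
        rw [hL]; nlinarith [mul_nonneg hε.le hM0]
      have h2 := mul_le_mul_of_nonneg_left h1 hk0.le
      have h3 : k * L = 1 := inv_mul_cancel₀ hL0.ne'
      nlinarith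
    refine ⟨?_, by linarith⟩
    rw [ENNReal.le_ofReal_iff_toReal_le hAfin.ne (by linarith)]
    linarith
  have hA : ∫⁻ x in Ioa' a, F x ≤ ENNReal.ofReal (k * (V + ε) - 1) := by
    rw [hEU, setLIntegral_iUnion_of_directed _ hEmono.directed_le]
    exact iSup_le fun n => (hbound n).1
  refine ⟨L, hL0, ?_⟩
  calc _ ≤ ENNReal.ofReal L * (1 + ENNReal.ofReal (k * (V + ε) - 1)) := by gcongr
    _ = ENNReal.ofReal (V + ε) := by
      rw [← ENNReal.ofReal_one, ← ENNReal.ofReal_add zero_le_one (hbound 0).2,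
        ← ENNReal.ofReal_mul hL0.le]
      congr 1
      rw [hk]
      field_simp
      ring

end Multiplier

section Averaging

variable {a : ℝ≥0∞} {w φ g f : ℝ → ℝ}

/-- Admissible pairs for the lower bound: `v` is dominated by `w` in the Hardy–Littlewood sense
and `h` has perspective modular at most `1` with respect to `v`. -/
structure IsGoodPair (a : ℝ≥0∞) (φ w h v : ℝ → ℝ) : Prop where
  meas_h : Measurable h
  meas_v : Measurable v
  nonneg_h : ∀ t, 0 ≤ h t
  nonneg_v : ∀ t, 0 ≤ v t
  sub_le : ∀ s, 0 ≤ s →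
    ∫⁻ x in Ioa' a, ENNReal.ofReal (v x - s) ≤ ∫⁻ x in Ioa' a, ENNReal.ofReal (w x - s)
  oterm_le : ∫⁻ t in Ioa' a, oterm φ (h t) (v t) ≤ 1

/-- The interval of arguments on which the rearrangement of `G` takes the value `c`. -/
def levelInterval (a : ℝ≥0∞) (G : ℝ → ℝ) (c : ℝ) : Set ℝ :=
  Ioa' (volume {t ∈ Ioa' a | c ≤ G t}) \ Ioa' (volume {t ∈ Ioa' a | c < G t})

lemma measurableSet_levelInterval (G : ℝ → ℝ) (c : ℝ) : MeasurableSet (levelInterval a G c) :=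
  (measurableSet_Ioa' _).diff (measurableSet_Ioa' _)

lemma disjoint_levelInterval (G : ℝ → ℝ) {c d : ℝ} (hcd : c ≠ d) :
    Disjoint (levelInterval a G c) (levelInterval a G d) := by
  wlog h : c < d generalizing c d
  · exact (this hcd.symm (lt_of_le_of_ne (not_lt.1 h) hcd.symm)).symm
  rw [Set.disjoint_left]
  intro x hx hy
  refine hx.2 (Ioa'_mono (measure_mono ?_) hy.1)
  exact fun t ht => ⟨ht.1, h.trans_le ht.2⟩

lemma levelInterval_subset (G : ℝ → ℝ) (c : ℝ) : levelInterval a G c ⊆ Ioa' a :=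
  sdiff_subset.trans (Ioa'_mono ((measure_mono (sep_subset _ _)).trans_eq (volume_Ioa' a)))

lemma levelInterval_subset_Ioo {G : ℝ → ℝ} {c T : ℝ} (hc : 0 < c)
    (hG : ∀ t, t ∉ Ioo 0 T → G t = 0) : levelInterval a G c ⊆ Ioo 0 T := by
  rw [← Ioa'_ofReal T]
  refine sdiff_subset.trans (Ioa'_mono ?_)
  calc _ ≤ volume (Ioo 0 T) := measure_mono fun t ht => by
        by_contra h
        have := ht.2
        rw [hG t h] at this
        exact absurd this (not_le.2 hc)
    _ = ENNReal.ofReal T := by simp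

lemma volume_levelInterval {G : ℝ → ℝ} (hGm : Measurable G) {c T : ℝ} (hc : 0 < c)
    (hG : ∀ t, t ∉ Ioo 0 T → G t = 0) :
    volume (levelInterval a G c) = volume (G ⁻¹' {c} ∩ Ioa' a) := by
  have hfin : volume {t ∈ Ioa' a | c ≤ G t} < ∞ := by
    refine lt_of_le_of_lt (measure_mono (t := Ioo 0 T) fun t ht => ?_) (by simp)
    by_contra h
    have := ht.2
    rw [hG t h] at this
    exact absurd this (not_le.2 hc)
  have hle : volume {t ∈ Ioa' a | c < G t} ≤ volume {t ∈ Ioa' a | c ≤ G t} :=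
    measure_mono fun t ht => ⟨ht.1, le_of_lt ht.2⟩
  have hsub : {t ∈ Ioa' a | c < G t} ⊆ {t ∈ Ioa' a | c ≤ G t} := fun t ht => ⟨ht.1, le_of_lt ht.2⟩
  rw [levelInterval, measure_sdiff (Ioa'_mono hle) (measurableSet_Ioa' _).nullMeasurableSet
    (by rw [volume_Ioa']; exact (hle.trans_lt hfin).ne), volume_Ioa', volume_Ioa',
    ← measure_sdiff hsub ((measurableSet_Ioa' a).inter
      (measurableSet_lt measurable_const hGm)).nullMeasurableSet (hle.trans_lt hfin).ne]
  congr 1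
  ext t
  simp only [Set.mem_sdiff, mem_ofPred_eq, mem_inter_iff, mem_preimage, mem_singleton_iff]
  constructor
  · rintro ⟨⟨h1, h2⟩, h3⟩
    exact ⟨le_antisymm (not_lt.1 fun h => h3 ⟨h1, h⟩) h2, h1⟩
  · rintro ⟨rfl, h⟩
    exact ⟨⟨h, le_rfl⟩, fun hlt => lt_irrefl _ hlt.2⟩

/-- Every positive value of the rearrangement of a simple function is a value of the function. -/
lemma exists_mem_levelInterval (G : SimpleFunc ℝ ℝ) (hG0 : ∀ t, 0 ≤ G t) {x : ℝ} (hx : x ∈ Ioa' a)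
    (h0 : decRe a G x ≠ 0) : ∃ c ∈ G.range, 0 < c ∧ decRe a G x = ENNReal.ofReal c ∧
      x ∈ levelInterval a G c := by
  have habs : ∀ s, distr a G s = volume {t ∈ Ioa' a | s < G t} := fun s => by
    simp only [distr, abs_of_nonneg (hG0 _)]
  obtain ⟨M, hM⟩ : ∃ M, ∀ t, G t ≤ M :=
    ⟨G.range.sup' ⟨G 0, G.mem_range_self 0⟩ id, fun t => Finset.le_sup' id (G.mem_range_self t)⟩
  have hM0 : 0 ≤ M := (hG0 0).trans (hM 0)
  have hfin : decRe a G x < ∞ := by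
    refine lt_of_le_of_lt (sInf_le ⟨M, ⟨hM0, ?_⟩, rfl⟩) ENNReal.ofReal_lt_top
    rw [habs]
    convert zero_le (a := ENNReal.ofReal x)
    convert measure_empty (μ := volume)
    ext t
    simp [hM t]
  set c := (decRe a G x).toReal with hc
  have hc0 : 0 < c := ENNReal.toReal_pos h0 hfin.ne
  have hcx : decRe a G x = ENNReal.ofReal c := (ENNReal.ofReal_toReal hfin.ne).symm
  have hα : volume {t ∈ Ioa' a | c < G t} ≤ ENNReal.ofReal x := habs c ▸ distr_decRe_le hfin
  have hβ : ENNReal.ofReal x < volume {t ∈ Ioa' a | c ≤ G t} := by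
    set R := insert 0 (G.range.filter (· < c)) with hR
    set s := R.max' (Finset.insert_nonempty _ _) with hs
    have hsR : s ∈ R := Finset.max'_mem _ _
    have hs0 : 0 ≤ s := Finset.le_max' _ _ (Finset.mem_insert_self _ _)
    have hsc : s < c := by
      rcases Finset.mem_insert.1 hsR with h | h
      · rwa [h]
      · exact (Finset.mem_filter.1 h).2
    have h1 : ENNReal.ofReal s < decRe a G x := by
      rw [hcx]; exact (ENNReal.ofReal_lt_ofReal_iff hc0).2 hsc
    rw [ofReal_lt_decRe_iff hs0, habs] at h1
    refine h1.trans_le (measure_mono fun t ht => ⟨ht.1, ?_⟩)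
    by_contra! h
    exact absurd ht.2 (not_lt.2 (Finset.le_max' _ _ (Finset.mem_insert_of_mem
      (Finset.mem_filter.2 ⟨G.mem_range_self t, h⟩))))
  refine ⟨c, ?_, hc0, hcx, ⟨⟨hx.1, hβ⟩, fun h => absurd h.2 (not_lt.2 hα)⟩⟩
  by_contra hcr
  refine absurd (hα.trans_lt hβ) (not_lt.2 (measure_mono fun t ht => ⟨ht.1, ?_⟩))
  refine lt_of_le_of_ne ht.2 fun h => hcr ?_
  rw [h]
  exact G.mem_range_self t

lemma lintegral_map_simpleFunc (G : SimpleFunc ℝ ℝ) {T : ℝ}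
    (hG : ∀ t, t ∉ Ioo 0 T → G t = 0) {X : ℝ → ℝ≥0∞} (hX : ∀ c ≤ 0, X c = 0) :
    ∫⁻ t in Ioa' a, X (G t) = ∑ c ∈ G.range, X c * volume (levelInterval a G c) := by
  have h := SimpleFunc.map_lintegral (μ := volume.restrict (Ioa' a)) X G
  rw [← SimpleFunc.lintegral_eq_lintegral] at h
  calc ∫⁻ t in Ioa' a, X (G t) = ∫⁻ t in Ioa' a, (G.map X) t := rfl
    _ = _ := h
    _ = _ := by
      refine Finset.sum_congr rfl fun c _ => ?_
      rcases le_or_gt c 0 with hc | hc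
      · rw [hX c hc, zero_mul, zero_mul]
      · rw [volume_levelInterval G.measurable hc hG, Measure.restrict_apply
          (G.measurableSet_preimage _)]

lemma lintegral_map_simpleFunc_le (G : SimpleFunc ℝ ℝ) {T : ℝ}
    (hG : ∀ t, t ∉ Ioo 0 T → G t = 0) {X : ℝ → ℝ≥0∞} (hX : ∀ c ≤ 0, X c = 0) {K : ℝ → ℝ≥0∞}
    (hK : ∀ c, 0 < c → X c * volume (levelInterval a G c) ≤ ∫⁻ x in levelInterval a G c, K x) :
    ∫⁻ t in Ioa' a, X (G t) ≤ ∫⁻ t in Ioa' a, K t := by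
  rw [lintegral_map_simpleFunc G hG hX]
  calc _ ≤ ∑ c ∈ G.range, ∫⁻ x in levelInterval a G c, K x := by
        refine Finset.sum_le_sum fun c _ => ?_
        rcases le_or_gt c 0 with hc | hc
        · simp [hX c hc]
        · exact hK c hc
    _ = ∫⁻ x in ⋃ c ∈ G.range, levelInterval a G c, K x := by
        rw [lintegral_biUnion_finset (fun c _ d _ h => disjoint_levelInterval _ h)
          fun c _ => measurableSet_levelInterval _ c]
    _ ≤ _ := lintegral_mono_set (iUnion₂_subset fun c _ => levelInterval_subset _ c)

/-- Averaging over the level intervals of a simple function `G` produces a good pair. -/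
lemma IsWeight.exists_goodPair_simpleFunc (hw : IsWeight a w) (hφ : IsNFn φ)
    (G : SimpleFunc ℝ ℝ) (hG0 : ∀ t, 0 ≤ G t) {T : ℝ} (hT : T ∈ Ioa' a)
    (hG : ∀ t, t ∉ Ioo 0 T → G t = 0) (hf : Measurable f) (hf0 : ∀ t, 0 ≤ f t)
    (hM : orliczMod a φ w f ≤ 1) :
    ∃ h v, IsGoodPair a φ w h v ∧
      decPair a w G f ≤ ∫⁻ t in Ioa' a, ENNReal.ofReal (G t) * ENNReal.ofReal (h t) := by
  set J := levelInterval a G with hJ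
  have hJm : ∀ c, MeasurableSet (J c) := measurableSet_levelInterval G
  have hJI : ∀ c, J c ⊆ Ioa' a := levelInterval_subset G
  have hJT : ∀ c, 0 < c → J c ⊆ Ioo 0 T := fun c hc => levelInterval_subset_Ioo hc hG
  have hJfin : ∀ c, 0 < c → volume (J c) < ∞ := fun c hc =>
    (measure_mono (hJT c hc)).trans_lt (by simp)
  set V : ℝ → ℝ≥0∞ := fun c => ∫⁻ x in J c, ENNReal.ofReal (w x) with hV
  set H : ℝ → ℝ≥0∞ := fun c => ∫⁻ x in J c, ENNReal.ofReal (f x * w x) with hH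
  have hVfin : ∀ c, 0 < c → V c < ∞ := fun c hc =>
    (lintegral_mono_set (hJT c hc)).trans_lt (hw.fin T hT)
  have hMJ : ∀ c, ∫⁻ x in J c, ENNReal.ofReal (φ (f x) * w x) < ∞ := fun c =>
    (lintegral_mono_set (hJI c)).trans_lt (hM.trans_lt ENNReal.one_lt_top)
  have hHfin : ∀ c, 0 < c → H c < ∞ := by
    intro c hc
    obtain ⟨C, hC0, hC⟩ := hφ.exists_le_add
    calc H c ≤ ∫⁻ x in J c, ENNReal.ofReal C * ENNReal.ofReal (w x) +
            ENNReal.ofReal (φ (f x) * w x) := by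
          refine setLIntegral_mono' (hJm c) fun x hx => ?_
          have hwx := (hw.pos x (hJI c hx)).le
          rw [← ENNReal.ofReal_mul hC0, ← ENNReal.ofReal_add (by positivity)
            (mul_nonneg (hφ.nonneg (hf0 x)) hwx)]
          refine ENNReal.ofReal_le_ofReal ?_
          nlinarith [mul_le_mul_of_nonneg_right (hC _ (hf0 x)) hwx]
      _ = ENNReal.ofReal C * V c + ∫⁻ x in J c, ENNReal.ofReal (φ (f x) * w x) := by
          rw [lintegral_add_left (hw.meas.ennreal_ofReal.const_mul _),
            lintegral_const_mul' _ _ ENNReal.ofReal_ne_top]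
      _ < ∞ := ENNReal.add_lt_top.2
          ⟨ENNReal.mul_lt_top ENNReal.ofReal_lt_top (hVfin c hc), hMJ c⟩
  set vc : ℝ → ℝ := fun c => if 0 < c then (V c / volume (J c)).toReal else 0 with hvc
  set hc : ℝ → ℝ := fun c => if 0 < c then (H c / volume (J c)).toReal else 0 with hhc
  have hvc0 : ∀ c, 0 ≤ vc c := fun c => by
    simp only [hvc]; split_ifs; exacts [ENNReal.toReal_nonneg, le_rfl]
  have hhc0 : ∀ c, 0 ≤ hc c := fun c => by
    simp only [hhc]; split_ifs; exacts [ENNReal.toReal_nonneg, le_rfl]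
  have hvmul : ∀ c, 0 < c → volume (J c) ≠ 0 → ENNReal.ofReal (vc c) * volume (J c) = V c := by
    intro c h h0
    simp only [hvc, if_pos h]
    rw [ENNReal.ofReal_toReal (ENNReal.div_lt_top (hVfin c h).ne h0).ne,
      ENNReal.div_mul_cancel h0 (hJfin c h).ne]
  have hhmul : ∀ c, 0 < c → volume (J c) ≠ 0 → ENNReal.ofReal (hc c) * volume (J c) = H c := by
    intro c h h0
    simp only [hhc, if_pos h]
    rw [ENNReal.ofReal_toReal (ENNReal.div_lt_top (hHfin c h).ne h0).ne,
      ENNReal.div_mul_cancel h0 (hJfin c h).ne]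
  have hvpos : ∀ c, 0 < c → volume (J c) ≠ 0 → 0 < vc c := by
    intro c h h0
    refine (hvc0 c).lt_of_ne fun h1 => ?_
    have h2 := hvmul c h h0
    rw [← h1, ENNReal.ofReal_zero, zero_mul, hV] at h2
    have h3 := (setLIntegral_pos_iff (μ := volume) (s := J c) hw.meas.ennreal_ofReal).2 (by
      refine lt_of_lt_of_le (pos_iff_ne_zero.2 h0) (measure_mono fun x hx => ⟨?_, hx⟩)
      simpa using hw.pos x (hJI c hx))
    exact absurd h2 h3.ne
  refine ⟨fun t => hc (G t), fun t => vc (G t), ⟨(G.map hc).measurable, (G.map vc).measurable,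
    fun t => hhc0 _, fun t => hvc0 _, fun s hs => ?_, ?_⟩, ?_⟩
  · refine lintegral_map_simpleFunc_le G hG (X := fun c => ENNReal.ofReal (vc c - s))
      (fun c hc => ?_) fun c hc => ?_
    · simp [hvc, not_lt.2 hc, hs]
    · by_cases h0 : volume (J c) = 0
      · simp [← hJ, h0]
      · rw [ENNReal.ofReal_sub _ hs, ENNReal.sub_mul (fun _ _ => (hJfin c hc).ne), hvmul c hc h0,
          tsub_le_iff_right, ← setLIntegral_const, ← lintegral_add_right _ measurable_const]
        refine lintegral_mono fun x => ?_
        simpa using ENNReal.ofReal_add_le (p := w x - s) (q := s)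
  · refine le_trans ?_ hM
    refine lintegral_map_simpleFunc_le G hG (X := fun c => oterm φ (hc c) (vc c))
      (fun c h => ?_) fun c h => ?_
    · simp [oterm, hvc, hhc, not_lt.2 h]
    · by_cases h0 : volume (J c) = 0
      · simp [← hJ, h0]
      · have hv := hvpos c h h0
        set x₀ := hc c / vc c with hx₀
        have hx0 : 0 ≤ x₀ := div_nonneg (hhc0 c) hv.le
        obtain ⟨m, hm, hline⟩ := hφ.exists_support_line hx0
        have hgint : ENNReal.ofReal (φ x₀) * V c + ENNReal.ofReal m * H c ≤
            (∫⁻ x in J c, ENNReal.ofReal (φ (f x) * w x)) + ENNReal.ofReal (m * x₀) * V c := by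
          rw [hV, hH, ← lintegral_const_mul' _ _ ENNReal.ofReal_ne_top,
            ← lintegral_const_mul' _ _ ENNReal.ofReal_ne_top,
            ← lintegral_const_mul' _ _ ENNReal.ofReal_ne_top,
            ← lintegral_add_left (hw.meas.ennreal_ofReal.const_mul _),
            ← lintegral_add_right _ (hw.meas.ennreal_ofReal.const_mul _)]
          refine setLIntegral_mono' (hJm c) fun x hx => ?_
          have hwx := (hw.pos x (hJI c hx)).le
          rw [← ENNReal.ofReal_mul (hφ.nonneg hx0), ← ENNReal.ofReal_mul hm,
            ← ENNReal.ofReal_mul (by positivity), ← ENNReal.ofReal_add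
              (mul_nonneg (hφ.nonneg hx0) hwx) (mul_nonneg hm (mul_nonneg (hf0 x) hwx)),
            ← ENNReal.ofReal_add (mul_nonneg (hφ.nonneg (hf0 x)) hwx) (by positivity)]
          refine ENNReal.ofReal_le_ofReal ?_
          nlinarith [mul_le_mul_of_nonneg_right (hline _ (hf0 x)) hwx]
        have hHV : ENNReal.ofReal m * H c = ENNReal.ofReal (m * x₀) * V c := by
          rw [← hvmul c h h0, ← hhmul c h h0, ← mul_assoc, ← mul_assoc, ← ENNReal.ofReal_mul hm,
            ← ENNReal.ofReal_mul (by positivity), hx₀]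
          congr 2
          field_simp
        rw [hHV] at hgint
        have := (ENNReal.add_le_add_iff_right
          (ENNReal.mul_lt_top ENNReal.ofReal_lt_top (hVfin c h)).ne).1 hgint
        rwa [oterm_of_pos hv, ENNReal.ofReal_mul (hφ.nonneg hx0), mul_assoc, ← hJ, hvmul c h h0]
  · set Y : ℝ → ℝ≥0∞ := fun c => ENNReal.ofReal c * ENNReal.ofReal (hc c) with hY
    have hR := lintegral_map_simpleFunc (a := a) G hG (X := Y) (fun c h => by
      simp [hY, ENNReal.ofReal_of_nonpos h])
    rw [hR]
    have hpt : ∀ x ∈ Ioa' a, decRe a G x * ENNReal.ofReal (f x * w x) ≤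
        ∑ c ∈ G.range, (J c).indicator
          (fun x => ENNReal.ofReal c * ENNReal.ofReal (f x * w x)) x := by
      intro x hx
      by_cases h0 : decRe a G x = 0
      · simp [h0]
      · obtain ⟨c, hcr, -, hcx, hxc⟩ := exists_mem_levelInterval G hG0 hx h0
        refine le_trans ?_ (Finset.single_le_sum (fun _ _ => zero_le) hcr)
        rw [indicator_of_mem hxc, hcx]
    calc decPair a w G f ≤ ∫⁻ x in Ioa' a, ∑ c ∈ G.range, (J c).indicator
          (fun x => ENNReal.ofReal c * ENNReal.ofReal (f x * w x)) x :=
          setLIntegral_mono' (measurableSet_Ioa' a) hpt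
      _ = ∑ c ∈ G.range, ENNReal.ofReal c * H c := by
          have hm : ∀ c, Measurable fun x => ENNReal.ofReal c * ENNReal.ofReal (f x * w x) :=
            fun c => (hf.mul hw.meas).ennreal_ofReal.const_mul _
          rw [lintegral_finsetSum _ fun c _ => (hm c).indicator (hJm c)]
          refine Finset.sum_congr rfl fun c _ => ?_
          rw [lintegral_indicator (hJm c), Measure.restrict_restrict (hJm c),
            inter_eq_left.2 (hJI c), lintegral_const_mul' _ _ ENNReal.ofReal_ne_top]
      _ ≤ _ := by
          refine Finset.sum_le_sum fun c _ => ?_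
          rcases le_or_gt c 0 with h | h
          · simp [ENNReal.ofReal_of_nonpos h]
          · rw [hY, mul_assoc]
            gcongr
            by_cases h0 : volume (J c) = 0
            · simp [hH, Measure.restrict_eq_zero.2 h0]
            · exact (hhmul c h h0).ge

/-- Monotone approximation of the rearrangement by rearrangements of simple functions. -/
lemma IsWeight.decPair_le_iSup_goodPair (hw : IsWeight a w) (ha : 0 < a) (hφ : IsNFn φ)
    (hg : Measurable g) (hf : Measurable f) (hf0 : ∀ t, 0 ≤ f t) (hM : orliczMod a φ w f ≤ 1) :
    decPair a w g f ≤ ⨆ p ∈ {p : (ℝ → ℝ) × (ℝ → ℝ) | IsGoodPair a φ w p.1 p.2},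
      ∫⁻ t in Ioa' a, ENNReal.ofReal |g t * p.1 t| := by
  obtain ⟨T, hTm, hT, hIT⟩ := exists_exhaustion ha
  set F : ℝ → ℝ≥0∞ := fun x => ENNReal.ofReal |g x| with hF
  have hFm : Measurable F := hg.abs.ennreal_ofReal
  set G : ℕ → SimpleFunc ℝ ℝ := fun n =>
    ((SimpleFunc.eapprox F n).map ENNReal.toReal).restrict (Ioo 0 (T n)) with hG
  have hGin : ∀ n, ∀ x ∈ Ioo 0 (T n), G n x = (SimpleFunc.eapprox F n x).toReal := fun n x hx => by
    simp only [hG, SimpleFunc.restrict_apply _ measurableSet_Ioo, indicator_of_mem hx,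
      SimpleFunc.map_apply]
  have hGout : ∀ n, ∀ x, x ∉ Ioo 0 (T n) → G n x = 0 := fun n x hx => by
    simp only [hG, SimpleFunc.restrict_apply _ measurableSet_Ioo, indicator_of_notMem hx]
  have hG0 : ∀ n x, 0 ≤ G n x := fun n x => by
    by_cases hx : x ∈ Ioo 0 (T n)
    · rw [hGin n x hx]; exact ENNReal.toReal_nonneg
    · rw [hGout n x hx]
  have hGmono : ∀ x, Monotone fun n => G n x := fun x n m hnm => by
    by_cases hx : x ∈ Ioo 0 (T n)
    · have hx' : x ∈ Ioo 0 (T m) := ⟨hx.1, hx.2.trans_le (hTm hnm)⟩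
      simp only [hGin n x hx, hGin m x hx']
      exact ENNReal.toReal_mono (SimpleFunc.eapprox_lt_top F m x).ne
        (SimpleFunc.monotone_eapprox F hnm x)
    · simp only [hGout n x hx]; exact hG0 m x
  have hGle : ∀ n x, G n x ≤ |g x| := fun n x => by
    by_cases hx : x ∈ Ioo 0 (T n)
    · rw [hGin n x hx]
      refine ENNReal.toReal_le_of_le_ofReal (abs_nonneg _) ?_
      change _ ≤ F x
      rw [← SimpleFunc.iSup_eapprox_apply hFm x]
      exact le_iSup (fun n => SimpleFunc.eapprox F n x) n
    · rw [hGout n x hx]; exact abs_nonneg _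
  have hGlim : ∀ x ∈ Ioa' a, ∀ s, 0 ≤ s → s < |g x| → ∃ n, s < G n x := by
    intro x hx s hs hsx
    rw [hIT] at hx
    obtain ⟨n, hn⟩ := mem_iUnion.1 hx
    have h1 : ENNReal.ofReal s < F x := (ENNReal.ofReal_lt_ofReal_iff (hs.trans_lt hsx)).2 hsx
    rw [← SimpleFunc.iSup_eapprox_apply hFm x] at h1
    obtain ⟨m, hm⟩ := lt_iSup_iff.1 h1
    have hx' : x ∈ Ioo 0 (T (max n m)) := ⟨hn.1, hn.2.trans_le (hTm (le_max_left _ _))⟩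
    refine ⟨max n m, ?_⟩
    rw [hGin _ x hx']
    exact (ENNReal.ofReal_lt_iff_lt_toReal hs (SimpleFunc.eapprox_lt_top F _ x).ne).1
      (hm.trans_le (SimpleFunc.monotone_eapprox F (le_max_right n m) x))
  have hdistr : ∀ n s, distr a (G n) s = volume {t ∈ Ioa' a | s < G n t} := fun n s => by
    simp only [distr, abs_of_nonneg (hG0 n _)]
  have hdmono : ∀ s, Monotone fun n => {t ∈ Ioa' a | s < G n t} := fun s n m hnm t ht =>
    ⟨ht.1, lt_of_lt_of_le ht.2 (hGmono t hnm)⟩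
  have hdecmono : ∀ x, Monotone fun n => decRe a (G n) x := fun x n m hnm =>
    le_of_forall_ofReal_lt fun s hs h => by
      rw [ofReal_lt_decRe_iff hs, hdistr] at h ⊢
      exact h.trans_le (measure_mono (hdmono s hnm))
  have hdec : ∀ x, decRe a g x ≤ ⨆ n, decRe a (G n) x := fun x =>
    le_of_forall_ofReal_lt fun s hs h => by
      rw [ofReal_lt_decRe_iff hs] at h
      have hU : {t ∈ Ioa' a | s < |g t|} = ⋃ n, {t ∈ Ioa' a | s < G n t} := by
        ext t
        simp only [mem_ofPred_eq, mem_iUnion]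
        exact ⟨fun h => (hGlim t h.1 s hs h.2).imp fun n hn => ⟨h.1, hn⟩,
          fun ⟨n, h⟩ => ⟨h.1, h.2.trans_le (hGle n t)⟩⟩
      rw [distr, hU, (hdmono s).measure_iUnion] at h
      obtain ⟨n, hn⟩ := lt_iSup_iff.1 h
      rw [← hdistr, ← ofReal_lt_decRe_iff hs] at hn
      exact hn.trans_le (le_iSup (fun n => decRe a (G n) x) n)
  calc decPair a w g f ≤ ∫⁻ x in Ioa' a, ⨆ n, decRe a (G n) x * ENNReal.ofReal (f x * w x) := by
        refine lintegral_mono fun x => ?_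
        rw [← ENNReal.iSup_mul]
        exact mul_le_mul_left (hdec x) _
    _ = ⨆ n, decPair a w (G n) f := lintegral_iSup
        (fun n => measurable_decPair_integrand hw.meas hf)
        fun n m hnm x => mul_le_mul_left (hdecmono x hnm) _
    _ ≤ _ := by
        refine iSup_le fun n => ?_
        obtain ⟨h, v, hgood, hle⟩ :=
          hw.exists_goodPair_simpleFunc hφ (G n) (hG0 n) (hT n) (hGout n) hf hf0 hM
        refine hle.trans (le_trans ?_ (le_iSup₂_of_le (h, v) hgood le_rfl))
        refine lintegral_mono fun t => ?_
        rw [abs_mul, ENNReal.ofReal_mul (abs_nonneg _), abs_of_nonneg (hgood.nonneg_h t)]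
        gcongr
        exact hGle n t

end Averaging

section GlidingHump

variable {a : ℝ≥0∞} {w φ g : ℝ → ℝ}

lemma IsNFn.measurable_oterm (hφ : IsNFn φ) {h v : ℝ → ℝ} (hh : Measurable h) (hv : Measurable v)
    (hh0 : ∀ t, 0 ≤ h t) (hv0 : ∀ t, 0 ≤ v t) : Measurable fun t => oterm φ (h t) (v t) := by
  unfold oterm
  refine Measurable.ite (measurableSet_eq_fun hv measurable_const)
    (Measurable.ite (measurableSet_eq_fun hh measurable_const) measurable_const measurable_const) ?_
  exact ((hφ.measurable_comp (hh.div hv) fun t => div_nonneg (hh0 t) (hv0 t)).mul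
    hv).ennreal_ofReal

lemma IsWeight.Pmod_le_of_isGoodPair (hw : IsWeight a w) {h v : ℝ → ℝ} (hp : IsGoodPair a φ w h v) :
    Pmod a φ w h ≤ 1 := by
  refine (iInf₂_le v ⟨hp.meas_v, hp.nonneg_v, ?_⟩).trans
    ((lintegral_congr fun t => ?_).trans_le hp.oterm_le)
  · exact (otermE_ofReal_abs φ (h t) (v t)).trans (by rw [abs_of_nonneg (hp.nonneg_h t)])
  · exact submaj_of_lintegral_sub_le hp.meas_v hp.nonneg_v hw.meas hw.pos hw.anti hp.sub_le

lemma IsWeight.mem_Pclass_of_isGoodPair (hw : IsWeight a w) {h v : ℝ → ℝ} (hp : IsGoodPair a φ w h v) :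
    h ∈ Pclass a φ w := by
  refine ⟨hp.meas_h, 1, one_pos, ?_⟩
  simp only [one_mul]
  exact (hw.Pmod_le_of_isGoodPair hp).trans_lt ENNReal.one_lt_top

lemma oterm_tsum_le (hφ : IsNFn φ) {d : ℕ → ℝ≥0∞} (hd0 : ∀ n, d n ≠ 0) {h v : ℕ → ℝ}
    (hh0 : ∀ n, 0 ≤ h n) (hv0 : ∀ n, 0 ≤ v n)
    (hvfin : ∑' n, d n * ENNReal.ofReal (v n) ≠ ∞) (hhfin : ∑' n, d n * ENNReal.ofReal (h n) ≠ ∞) :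
    oterm φ (∑' n, d n * ENNReal.ofReal (h n)).toReal (∑' n, d n * ENNReal.ofReal (v n)).toReal ≤
      ∑' n, d n * oterm φ (h n) (v n) := by
  set Ev := ∑' n, d n * ENNReal.ofReal (v n) with hEv
  set Eh := ∑' n, d n * ENNReal.ofReal (h n) with hEh
  rcases eq_or_ne Ev 0 with h0 | h0
  · by_cases hO : ∑' n, d n * oterm φ (h n) (v n) = ∞
    · rw [hO]; exact le_top
    have hvn : ∀ n, v n = 0 := fun n => by
      have := ENNReal.tsum_eq_zero.1 (hEv ▸ h0) n
      rw [mul_eq_zero, or_iff_right (hd0 n), ENNReal.ofReal_eq_zero] at this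
      exact le_antisymm this (hv0 n)
    have hhn : ∀ n, h n = 0 := fun n => by
      by_contra hne
      refine ENNReal.ne_top_of_tsum_ne_top hO n ?_
      simp [oterm, hvn, hne, hd0 n]
    have : Eh = 0 := by simp [hEh, hhn]
    simp [this, h0, oterm]
  · have hv : 0 < Ev.toReal := ENNReal.toReal_pos h0 hvfin
    set x₀ := Eh.toReal / Ev.toReal with hx₀
    have hx0 : 0 ≤ x₀ := div_nonneg ENNReal.toReal_nonneg hv.le
    obtain ⟨m, hm, hline⟩ := hφ.exists_support_line hx0
    have hsum : ENNReal.ofReal (φ x₀) * Ev + ENNReal.ofReal m * Eh ≤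
        ∑' n, d n * oterm φ (h n) (v n) + ENNReal.ofReal (m * x₀) * Ev := by
      rw [hEv, hEh, ← ENNReal.tsum_mul_left, ← ENNReal.tsum_mul_left, ← ENNReal.tsum_mul_left,
        ← ENNReal.tsum_add, ← ENNReal.tsum_add]
      refine ENNReal.tsum_le_tsum fun n => ?_
      have := mul_le_mul_right (oterm_add_le hx0 hm hφ hline (hh0 n) (hv0 n)) (d n)
      calc _ = d n * (ENNReal.ofReal (φ x₀) * ENNReal.ofReal (v n) +
            ENNReal.ofReal m * ENNReal.ofReal (h n)) := by ring
        _ ≤ _ := this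
        _ = _ := by ring
    have hEq : ENNReal.ofReal m * Eh = ENNReal.ofReal (m * x₀) * Ev := by
      rw [← ENNReal.ofReal_toReal hvfin, ← ENNReal.ofReal_toReal hhfin, ← ENNReal.ofReal_mul hm,
        ← ENNReal.ofReal_mul (by positivity), hx₀]
      congr 1
      field_simp
    rw [hEq] at hsum
    have := (ENNReal.add_le_add_iff_right
      (ENNReal.mul_lt_top ENNReal.ofReal_lt_top hvfin.lt_top).ne).1 hsum
    rwa [oterm_of_pos hv, ENNReal.ofReal_mul (hφ.nonneg hx0), ENNReal.ofReal_toReal hvfin]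

/-- Good pairs are stable under countable convex combinations. -/
lemma IsWeight.exists_goodPair_tsum (hw : IsWeight a w) (ha : 0 < a) (hφ : IsNFn φ)
    {d : ℕ → ℝ≥0∞} (hd0 : ∀ n, d n ≠ 0) (hd1 : ∑' n, d n = 1) {h v : ℕ → ℝ → ℝ}
    (hp : ∀ n, IsGoodPair a φ w (h n) (v n)) :
    ∃ H, (∃ u, IsGoodPair a φ w H u) ∧ ∀ᵐ t ∂volume.restrict (Ioa' a), ∀ n,
      d n * ENNReal.ofReal (h n t) ≤ ENNReal.ofReal (H t) := by
  set Ev : ℝ → ℝ≥0∞ := fun t => ∑' n, d n * ENNReal.ofReal (v n t) with hEv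
  set Eh : ℝ → ℝ≥0∞ := fun t => ∑' n, d n * ENNReal.ofReal (h n t) with hEh
  have hEvm : Measurable Ev :=
    Measurable.tsum fun n => (hp n).meas_v.ennreal_ofReal.const_mul _
  have hEhm : Measurable Eh :=
    Measurable.tsum fun n => (hp n).meas_h.ennreal_ofReal.const_mul _
  have hom : ∀ n, Measurable fun t => d n * oterm φ (h n t) (v n t) := fun n =>
    (hφ.measurable_oterm (hp n).meas_h (hp n).meas_v (hp n).nonneg_h (hp n).nonneg_v).const_mul _
  have hO : ∫⁻ t in Ioa' a, ∑' n, d n * oterm φ (h n t) (v n t) ≤ 1 := by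
    rw [lintegral_tsum fun n => (hom n).aemeasurable, ← hd1]
    refine ENNReal.tsum_le_tsum fun n => ?_
    rw [lintegral_const_mul _ (hφ.measurable_oterm (hp n).meas_h (hp n).meas_v (hp n).nonneg_h
      (hp n).nonneg_v)]
    exact (mul_le_mul_right (hp n).oterm_le _).trans_eq (mul_one _)
  have hsm : ∀ s n, Measurable fun t => ENNReal.ofReal (v n t - s) := fun s n =>
    ((hp n).meas_v.sub_const s).ennreal_ofReal
  have hsub : ∀ s, 0 ≤ s → ∫⁻ t in Ioa' a, ∑' n, d n * ENNReal.ofReal (v n t - s) ≤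
      ∫⁻ t in Ioa' a, ENNReal.ofReal (w t - s) := by
    intro s hs
    rw [lintegral_tsum fun n => ((hsm s n).const_mul _).aemeasurable]
    calc _ ≤ ∑' n, d n * ∫⁻ t in Ioa' a, ENNReal.ofReal (w t - s) := by
          refine ENNReal.tsum_le_tsum fun n => ?_
          rw [lintegral_const_mul _ (hsm s n)]
          exact mul_le_mul_right ((hp n).sub_le s hs) _
      _ = _ := by rw [ENNReal.tsum_mul_right, hd1, one_mul]
  have hEvle : ∀ s t, Ev t ≤ (∑' n, d n * ENNReal.ofReal (v n t - s)) + ENNReal.ofReal s := by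
    intro s t
    calc Ev t ≤ ∑' n, (d n * ENNReal.ofReal (v n t - s) + d n * ENNReal.ofReal s) := by
          refine ENNReal.tsum_le_tsum fun n => ?_
          rw [← mul_add]
          refine mul_le_mul_right ?_ _
          simpa using ENNReal.ofReal_add_le (p := v n t - s) (q := s)
      _ = _ := by rw [ENNReal.tsum_add, ENNReal.tsum_mul_right (a := ENNReal.ofReal s), hd1, one_mul]
  have hEvfin : ∀ᵐ t ∂volume.restrict (Ioa' a), Ev t < ∞ := by
    obtain ⟨T, -, hT, -⟩ := exists_exhaustion ha
    have hfin : ∫⁻ t in Ioa' a, ENNReal.ofReal (w t - w (T 0)) < ∞ := by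
      rw [setLIntegral_eq_of_eq_zero (measurableSet_Ioa' a) measurableSet_Ioo
        (Ioo_subset_Ioa' (hT 0))]
      · refine lt_of_le_of_lt (lintegral_mono fun t => ENNReal.ofReal_le_ofReal ?_)
          (hw.fin _ (hT 0))
        linarith [hw.pos _ (hT 0)]
      · intro t ht htT
        have : T 0 ≤ t := not_lt.1 fun h => htT ⟨ht.1, h⟩
        simpa using hw.anti _ (hT 0) _ ht this
    have := ae_lt_top (μ := volume.restrict (Ioa' a))
      (Measurable.tsum fun n => (hsm (w (T 0)) n).const_mul (d n))
      ((hsub _ (hw.pos _ (hT 0)).le).trans_lt hfin).ne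
    filter_upwards [this] with t ht
    exact (hEvle _ t).trans_lt (ENNReal.add_lt_top.2 ⟨ht, ENNReal.ofReal_lt_top⟩)
  have hEhfin : ∀ᵐ t ∂volume.restrict (Ioa' a), Eh t < ∞ := by
    obtain ⟨C, hC0, hC⟩ := hφ.exists_le_add
    filter_upwards [hEvfin, ae_lt_top (Measurable.tsum hom)
      (hO.trans_lt ENNReal.one_lt_top).ne] with t ht hOt
    calc Eh t ≤ ∑' n, (ENNReal.ofReal C * (d n * ENNReal.ofReal (v n t)) +
            d n * oterm φ (h n t) (v n t)) := by
          refine ENNReal.tsum_le_tsum fun n => ?_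
          calc d n * ENNReal.ofReal (h n t) ≤ d n * _ := mul_le_mul_right
                (oterm_le_add hC0 hφ hC ((hp n).nonneg_h t) ((hp n).nonneg_v t)) _
            _ = _ := by ring
      _ = ENNReal.ofReal C * Ev t + ∑' n, d n * oterm φ (h n t) (v n t) := by
          rw [ENNReal.tsum_add, ENNReal.tsum_mul_left]
      _ < ∞ := ENNReal.add_lt_top.2 ⟨ENNReal.mul_lt_top ENNReal.ofReal_lt_top ht, hOt⟩
  refine ⟨fun t => (Eh t).toReal, ⟨fun t => (Ev t).toReal, hEhm.ennreal_toReal,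
    hEvm.ennreal_toReal, fun _ => ENNReal.toReal_nonneg, fun _ => ENNReal.toReal_nonneg,
    fun s hs => ?_, ?_⟩, ?_⟩
  · refine le_trans (lintegral_mono fun t => ?_) (hsub s hs)
    rw [ENNReal.ofReal_sub _ hs, tsub_le_iff_right]
    exact ENNReal.ofReal_toReal_le.trans (hEvle s t)
  · refine le_trans (lintegral_mono_ae ?_) hO
    filter_upwards [hEvfin, hEhfin] with t h1 h2
    exact oterm_tsum_le hφ hd0 (fun n => (hp n).nonneg_h t) (fun n => (hp n).nonneg_v t) h1.ne h2.ne
  · filter_upwards [hEhfin] with t ht n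
    rw [ENNReal.ofReal_toReal ht.ne]
    exact ENNReal.le_tsum n

/-- A function in the Köthe dual is uniformly bounded on good pairs. -/
lemma IsWeight.iSup_goodPair_lt_top (hw : IsWeight a w) (ha : 0 < a) (hφ : IsNFn φ)
    (hgint : ∀ h ∈ Pclass a φ w, IntegrableOn (fun t => g t * h t) (Ioa' a)) :
    (⨆ p ∈ {p : (ℝ → ℝ) × (ℝ → ℝ) | IsGoodPair a φ w p.1 p.2},
      ∫⁻ t in Ioa' a, ENNReal.ofReal |g t * p.1 t|) < ∞ := by
  by_contra! htop
  rw [top_le_iff] at htop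
  set d : ℕ → ℝ≥0∞ := fun n => 2⁻¹ ^ (n + 1) with hd
  have hd0 : ∀ n, d n ≠ 0 := fun n => by simp [hd]
  have hdtop : ∀ n, d n ≠ ∞ := fun n => by simp [hd]
  have hd1 : ∑' n, d n = 1 := by
    rw [hd, ENNReal.tsum_geometric_add_one, ENNReal.one_sub_inv_two, inv_inv]
    exact ENNReal.inv_mul_cancel two_ne_zero ENNReal.ofNat_ne_top
  have hex : ∀ n : ℕ, ∃ p : (ℝ → ℝ) × (ℝ → ℝ), IsGoodPair a φ w p.1 p.2 ∧
      (n : ℝ≥0∞) * (d n)⁻¹ ≤ ∫⁻ t in Ioa' a, ENNReal.ofReal |g t * p.1 t| := by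
    intro n
    have hlt : (n : ℝ≥0∞) * (d n)⁻¹ < ∞ :=
      ENNReal.mul_lt_top (ENNReal.natCast_lt_top n) (ENNReal.inv_lt_top.2 (pos_iff_ne_zero.2 (hd0 n)))
    rw [← htop] at hlt
    obtain ⟨p, hp⟩ := lt_iSup_iff.1 hlt
    obtain ⟨hgood, hp⟩ := lt_iSup_iff.1 hp
    exact ⟨p, hgood, hp.le⟩
  choose p hgood hp using hex
  obtain ⟨H, ⟨u, hHu⟩, hH⟩ := hw.exists_goodPair_tsum ha hφ hd0 hd1 hgood
  have hfin := (hgint H (hw.mem_Pclass_of_isGoodPair hHu)).2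
  rw [hasFiniteIntegral_iff_norm] at hfin
  obtain ⟨n, hn⟩ := ENNReal.exists_nat_gt hfin.ne
  refine absurd hn (not_lt.2 ?_)
  calc (n : ℝ≥0∞) = d n * (n * (d n)⁻¹) := by
        rw [mul_left_comm, ENNReal.mul_inv_cancel (hd0 n) (hdtop n), mul_one]
    _ ≤ d n * ∫⁻ t in Ioa' a, ENNReal.ofReal |g t * (p n).1 t| := mul_le_mul_right (hp n) _
    _ = ∫⁻ t in Ioa' a, d n * ENNReal.ofReal |g t * (p n).1 t| :=
        (lintegral_const_mul' _ _ (hdtop n)).symm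
    _ ≤ _ := by
        refine lintegral_mono_ae ?_
        filter_upwards [hH] with t ht
        rw [Real.norm_eq_abs, abs_mul, abs_mul, ENNReal.ofReal_mul (abs_nonneg _),
          ENNReal.ofReal_mul (abs_nonneg _), mul_left_comm,
          abs_of_nonneg ((hgood n).nonneg_h t), abs_of_nonneg (hHu.nonneg_h t)]
        exact mul_le_mul_right (ht n) _

end GlidingHump

section Norms

variable {a : ℝ≥0∞} {w φ g : ℝ → ℝ}

lemma le_of_forall_one_lt_mul {x y : ℝ≥0∞} (h : ∀ δ : ℝ, 1 < δ → x ≤ ENNReal.ofReal δ * y) :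
    x ≤ y := by
  have ht : Tendsto (fun δ : ℝ => ENNReal.ofReal δ * y) (𝓝[>] 1) (𝓝 y) := by
    have h1 : Tendsto (fun δ : ℝ => ENNReal.ofReal δ) (𝓝[>] 1) (𝓝 1) := by
      simpa using ENNReal.tendsto_ofReal (tendsto_id.mono_left nhdsWithin_le_nhds :
        Tendsto (fun δ : ℝ => δ) (𝓝[>] 1) (𝓝 1))
    simpa using ENNReal.Tendsto.mul_const (b := y) h1 (Or.inl one_ne_zero)
  exact ge_of_tendsto ht (eventually_nhdsWithin_of_forall fun δ hδ => h δ hδ)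

lemma decPair_le_lamOnorm {f : ℝ → ℝ} (hf : Measurable f) (hf0 : ∀ t, 0 ≤ f t)
    (hM : orliczMod a φ w f ≤ 1) : decPair a w g f ≤ lamOnorm a φ w g := by
  refine le_iSup₂_of_le f ⟨hf, hf0, ?_⟩ le_rfl
  refine (iInf₂_le 1 ⟨one_pos, ?_⟩).trans ENNReal.ofReal_one.le
  simpa only [orliczMod, div_one, abs_of_nonneg (hf0 _)] using hM

lemma lamOnorm_le {S : ℝ≥0∞} (hS : ∀ f : ℝ → ℝ, Measurable f → (∀ t, 0 ≤ f t) →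
    orliczMod a φ w f ≤ 1 → decPair a w g f ≤ S) : lamOnorm a φ w g ≤ S := by
  refine iSup₂_le fun f ⟨hf, hf0, hlux⟩ => le_of_forall_one_lt_mul fun δ hδ => ?_
  have hlt : luxNorm a φ w f < ENNReal.ofReal δ :=
    hlux.trans_lt (by rwa [ENNReal.one_lt_ofReal])
  obtain ⟨ε, hlt⟩ := iInf_lt_iff.1 hlt
  obtain ⟨⟨hε, hM⟩, hlt⟩ := iInf_lt_iff.1 hlt
  have h1 : orliczMod a φ w (fun t => f t / ε) ≤ 1 := by
    simpa only [orliczMod, abs_of_nonneg (hf0 _)] using hM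
  have h2 := hS _ (hf.div_const ε) (fun t => div_nonneg (hf0 t) hε.le) h1
  calc decPair a w g f = decPair a w g (fun t => ε * (f t / ε)) := by
        simp only [mul_div_cancel₀ _ hε.ne']
    _ = ENNReal.ofReal ε * decPair a w g (fun t => f t / ε) := decPair_const_mul ε hε.le _
    _ ≤ ENNReal.ofReal δ * S := mul_le_mul' hlt.le h2

lemma PmodE_div {h : ℝ → ℝ} {ε : ℝ} (hε : 0 < ε) :
    PmodE a φ w (fun t => ENNReal.ofReal |h t| / ENNReal.ofReal ε) =
      Pmod a φ w fun t => h t / ε := by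
  simp only [Pmod, abs_div, abs_of_pos hε, ENNReal.ofReal_div_of_pos hε]

lemma IsWeight.Pnorm_le_one_of_isGoodPair (hw : IsWeight a w) {h v : ℝ → ℝ}
    (hp : IsGoodPair a φ w h v) : Pnorm a φ w h ≤ 1 := by
  refine (iInf₂_le 1 ⟨one_pos, ?_⟩).trans ENNReal.ofReal_one.le
  rw [PmodE_div one_pos]
  simpa only [div_one] using hw.Pmod_le_of_isGoodPair hp

lemma IsWeight.lintegral_mul_le_Pmod (hw : IsWeight a w) (hφ : IsNFn φ) (hg : Measurable g)
    (hgfin : ∀ t ∈ Ioa' a, decRe a g t < ∞) (h : ℝ → ℝ) {k : ℝ} (hk : 0 < k) :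
    ENNReal.ofReal k * ∫⁻ t in Ioa' a, ENNReal.ofReal |g t * h t| ≤
      Pmod a φ w h + ∫⁻ t in Ioa' a, ENNReal.ofReal (w t) *
          ENNReal.ofReal (conjFn φ (k * (decRe a g t).toReal)) := by
  rw [← tsub_le_iff_right]
  refine le_iInf₂ fun v ⟨hv, hv0, hvw⟩ => ?_
  rw [tsub_le_iff_right]
  exact hw.lintegral_mul_le hφ hg hgfin hv hv0 hvw hk

/-- Hölder's inequality for `𝓜_{φ,w}` and the Orlicz norm of `Λ_{φ*,w}`. -/
lemma IsWeight.lintegral_mul_le_lamOnorm (hw : IsWeight a w) (ha : 0 < a) (hφ : IsNFn φ)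
    (hg : Measurable g) {h : ℝ → ℝ} (hh : Pnorm a φ w h ≤ 1) :
    ∫⁻ t in Ioa' a, ENNReal.ofReal |g t * h t| ≤ lamOnorm a φ w g := by
  by_cases htop : lamOnorm a φ w g = ∞
  · rw [htop]; exact le_top
  set V := (lamOnorm a φ w g).toReal with hVdef
  have hV0 : 0 ≤ V := ENNReal.toReal_nonneg
  have hVeq : ENNReal.ofReal V = lamOnorm a φ w g := ENNReal.ofReal_toReal htop
  have hV : ∀ f : ℝ → ℝ, Measurable f → (∀ t, 0 ≤ f t) → orliczMod a φ w f ≤ 1 →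
      decPair a w g f ≤ ENNReal.ofReal V := fun f hf hf0 hM =>
    hVeq ▸ decPair_le_lamOnorm hf hf0 hM
  refine ENNReal.le_of_forall_pos_le_add fun ε hε _ => le_of_forall_one_lt_mul fun δ hδ => ?_
  obtain ⟨l, hl, hle⟩ := hw.exists_amemiya_le ha hφ hV0 hV (NNReal.coe_pos.2 hε)
  have hlt : Pnorm a φ w h < ENNReal.ofReal δ := hh.trans_lt (by rwa [ENNReal.one_lt_ofReal])
  obtain ⟨ρ, hlt⟩ := iInf_lt_iff.1 hlt
  obtain ⟨⟨hρ, hP⟩, hlt⟩ := iInf_lt_iff.1 hlt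
  rw [PmodE_div hρ] at hP
  have hY := hw.lintegral_mul_le_Pmod hφ hg (hw.decRe_lt_top hφ hV) (fun t => h t / ρ)
    (inv_pos.2 hl)
  calc ∫⁻ t in Ioa' a, ENNReal.ofReal |g t * h t|
      = ENNReal.ofReal ρ * ∫⁻ t in Ioa' a, ENNReal.ofReal |g t * (h t / ρ)| := by
        rw [← lintegral_const_mul' _ _ ENNReal.ofReal_ne_top]
        refine lintegral_congr fun t => ?_
        rw [← ENNReal.ofReal_mul hρ.le, ← abs_of_pos hρ, ← abs_mul, abs_of_pos hρ]
        congr 2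
        field_simp
    _ = ENNReal.ofReal ρ * (ENNReal.ofReal l * (ENNReal.ofReal l⁻¹ *
          ∫⁻ t in Ioa' a, ENNReal.ofReal |g t * (h t / ρ)|)) := by
        rw [← mul_assoc (ENNReal.ofReal l), ← ENNReal.ofReal_mul hl.le, mul_inv_cancel₀ hl.ne',
          ENNReal.ofReal_one, one_mul]
    _ ≤ ENNReal.ofReal δ * (lamOnorm a φ w g + ε) := by
        refine mul_le_mul' hlt.le ?_
        calc _ ≤ ENNReal.ofReal l * (1 + _) :=
              mul_le_mul_right (hY.trans (add_le_add hP le_rfl)) _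
          _ ≤ _ := hle
          _ = _ := by rw [ENNReal.ofReal_add hV0 ε.coe_nonneg, hVeq, ENNReal.ofReal_coe_nnreal]

lemma ofReal_conjFn_mul (hφ : IsNFn φ) (t x : ℝ) :
    ENNReal.ofReal (conjFn φ t * x) = ENNReal.ofReal x * ENNReal.ofReal (conjFn φ t) := by
  rw [ENNReal.ofReal_mul (hφ.conjFn_nonneg t), mul_comm]

lemma IsWeight.mem_LamClass (hw : IsWeight a w) (ha : 0 < a) (hφ : IsNFn φ) (hg : Measurable g)
    (hgint : ∀ h ∈ Pclass a φ w, IntegrableOn (fun t => g t * h t) (Ioa' a)) :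
    g ∈ LamClass a (conjFn φ) w := by
  have hS := hw.iSup_goodPair_lt_top ha hφ hgint
  have hV : ∀ f : ℝ → ℝ, Measurable f → (∀ t, 0 ≤ f t) → orliczMod a φ w f ≤ 1 →
      decPair a w g f ≤ ENNReal.ofReal (⨆ p ∈ {p : (ℝ → ℝ) × (ℝ → ℝ) | IsGoodPair a φ w p.1 p.2},
        ∫⁻ t in Ioa' a, ENNReal.ofReal |g t * p.1 t|).toReal := fun f hf hf0 hM => by
    rw [ENNReal.ofReal_toReal hS.ne]
    exact hw.decPair_le_iSup_goodPair ha hφ hg hf hf0 hM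
  obtain ⟨l, hl, hle⟩ := hw.exists_amemiya_le ha hφ ENNReal.toReal_nonneg hV one_pos
  refine ⟨hg, hw.decRe_lt_top hφ hV, l⁻¹, inv_pos.2 hl, ?_⟩
  simp only [ofReal_conjFn_mul hφ]
  by_contra! hc
  rw [top_le_iff.1 hc, add_top, ENNReal.mul_top (by simpa using hl), top_le_iff] at hle
  exact ENNReal.ofReal_ne_top hle

lemma IsWeight.integrableOn_mul (hw : IsWeight a w) (hφ : IsNFn φ)
    (hg : g ∈ LamClass a (conjFn φ) w) {h : ℝ → ℝ} (hh : h ∈ Pclass a φ w) :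
    IntegrableOn (fun t => g t * h t) (Ioa' a) := by
  obtain ⟨hgm, hgfin, k, hk, hA⟩ := hg
  obtain ⟨hhm, c, hc, hP⟩ := hh
  simp only [ofReal_conjFn_mul hφ] at hA
  have hY := (hw.lintegral_mul_le_Pmod hφ hgm hgfin (fun t => c * h t) hk).trans_lt
    (ENNReal.add_lt_top.2 ⟨hP, hA⟩)
  have hfin : ∫⁻ t in Ioa' a, ENNReal.ofReal |g t * (c * h t)| < ∞ := by
    by_contra! h
    rw [top_le_iff.1 h, ENNReal.mul_top (by simpa using hk)] at hY
    exact lt_irrefl _ hY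
  have hi : IntegrableOn (fun t => g t * (c * h t)) (Ioa' a) :=
    ⟨(hgm.mul (hhm.const_mul c)).aestronglyMeasurable, by
      rw [hasFiniteIntegral_iff_norm]; exact hfin⟩
  refine (hi.const_mul c⁻¹).congr (ae_of_all _ fun t => ?_)
  field_simp

end Norms

/-- for an `N`-function `φ` and a positive decreasing weight `w` with
`W(t) < ∞` on `I`, the Köthe dual of `𝓜_{φ,w}` is the Orlicz–Lorentz space `Λ_{φ*,w}`
with its Orlicz norm, with equality of norms:
`sup{∫_I |g·h| : h ∈ 𝓜_{φ,w}, ‖h‖_𝓜 ≤ 1} = ‖g‖⁰_{Λ_{φ*,w}}`. -/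
theorem statement19 (a : ℝ≥0∞) (ha : 0 < a) (φ : ℝ → ℝ) (hφ : IsNFn φ)
    (w : ℝ → ℝ) (hw_meas : Measurable w) (hw_pos : ∀ t ∈ Ioa' a, 0 < w t)
    (hw_dec : ∀ s ∈ Ioa' a, ∀ t ∈ Ioa' a, s ≤ t → w t ≤ w s)
    (hW : ∀ t ∈ Ioa' a, ∫⁻ s in Set.Ioo 0 t, ENNReal.ofReal (w s) < ∞) :
    ({g : ℝ → ℝ | Measurable g ∧ ∀ h ∈ Pclass a φ w,
        IntegrableOn (fun t => g t * h t) (Ioa' a)} =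
      LamClass a (conjFn φ) w) ∧
    ∀ g ∈ LamClass a (conjFn φ) w,
      (⨆ h ∈ {h : ℝ → ℝ | Measurable h ∧ Pnorm a φ w h ≤ 1},
          ∫⁻ t in Ioa' a, ENNReal.ofReal |g t * h t|) = lamOnorm a φ w g := by
  have hw : IsWeight a w := ⟨hw_meas, hw_pos, hw_dec, hW⟩
  refine ⟨Subset.antisymm (fun g hg => hw.mem_LamClass ha hφ hg.1 hg.2)
    fun g hg => ⟨hg.1, fun h hh => hw.integrableOn_mul hφ hg hh⟩, fun g hg => ?_⟩
  refine le_antisymm (iSup₂_le fun h hh => hw.lintegral_mul_le_lamOnorm ha hφ hg.1 hh.2)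
    (lamOnorm_le fun f hf hf0 hM => ?_)
  refine (hw.decPair_le_iSup_goodPair ha hφ hg.1 hf hf0 hM).trans (iSup₂_le fun p hp => ?_)
  exact le_iSup₂_of_le p.1 ⟨hp.meas_h, hw.Pnorm_le_one_of_isGoodPair hp⟩ le_rfl

end OrliczRearrangement

end
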